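/- arXiv:alg-geom/9610009 — 7 statements merged into one kernel-verified Lean document; each statement's English description precedes it below -/
import Mathlib

section
/- Let k be any field, let f = xyz + xyw + xzw + yzw ∈ k[x,y,z,w] be Cayley's cubic, and let q > 1 be an integer. Then the socle degree of the artinian ring k[x,y,z,w]/(f, x^q, y^q, z^q, w^q) equals 2q − 1; that is, there exists a homogeneous polynomial of degree 2q−1 not lying in the ideal (f, x^q, y^q, z^q, w^q), while every homogeneous polynomial of degree at least 2q lies in this ideal. -/
open MvPolynomial

/-- A function of four exponents, thought of as a functional on forms of degree `2 * r - 2`, which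
kills the multiples of the sum of the variables (as long as the last exponent is small) and the
monomials that miss a variable and have all exponents less than `r`. -/
structure IsCayleyFunctional {M : Type*} [AddCommGroup M] (r : ℕ) (G : ℕ → ℕ → ℕ → ℕ → M) :
    Prop where
  rel : ∀ a b c d, a + b + c + d + 3 = 2 * r → d < r →
    G (a + 1) b c d + G a (b + 1) c d + G a b (c + 1) d + G a b c (d + 1) = 0
  zero : ∀ a b c d, a + b + c + d + 2 = 2 * r → a < r → b < r → c < r → d < r →
    (a = 0 ∨ b = 0 ∨ c = 0 ∨ d = 0) → G a b c d = 0

namespace IsCayleyFunctional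

variable {M : Type*} [AddCommGroup M] {r : ℕ} {G : ℕ → ℕ → ℕ → ℕ → M}

theorem swap_left (h : IsCayleyFunctional r G) :
    IsCayleyFunctional r fun a b c d => G b a c d where
  rel a b c d hs hd := by
    rw [← h.rel b a c d (by lia) hd]; abel
  zero a b c d hs ha hb hc hd h0 := h.zero b a c d (by lia) hb ha hc hd (by tauto)

theorem swap_right (h : IsCayleyFunctional r G) :
    IsCayleyFunctional r fun a b c d => G a c b d where
  rel a b c d hs hd := by
    rw [← h.rel a c b d (by lia) hd]; abel
  zero a b c d hs ha hb hc hd h0 := h.zero a c b d (by lia) ha hc hb hd (by tauto)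

end IsCayleyFunctional

/-- An array satisfying a Pascal-type recursion on a triangle vanishes as soon as it vanishes on
complementary parts of the two legs. -/
theorem pascal_array_eq_zero {M : Type*} [AddCommGroup M] {D m : ℕ} (T : ℕ → ℕ → M)
    (rel : ∀ c d, c + d + 1 < D + m → T c d + T (c + 1) d + T c (d + 1) = 0)
    (h_left : ∀ d, D ≤ d → d < D + m → T 0 d = 0)
    (h_right : ∀ c, m ≤ c → c < D + m → T c 0 = 0) :
    ∀ c d, c + d < D + m → T c d = 0 := by
  have left : ∀ c d, D ≤ d → c + d < D + m → T c d = 0 := by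
    intro c
    induction c with
    | zero => intro d h1 h2; exact h_left d h1 (by lia)
    | succ c ih =>
      intro d h1 h2
      have := rel c d (by lia)
      rwa [ih d h1 (by lia), ih (d + 1) (by lia) (by lia), zero_add, add_zero] at this
  have right : ∀ d c, m ≤ c → c + d < D + m → T c d = 0 := by
    intro d
    induction d with
    | zero => intro c h1 h2; exact h_right c h1 (by lia)
    | succ d ih =>
      intro c h1 h2
      have := rel c d (by lia)
      rwa [ih c h1 (by lia), ih (c + 1) (by lia) (by lia), zero_add, zero_add] at this
  have descend : ∀ t c, m ≤ c + t → ∀ d, c + d < D + m → T c d = 0 := by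
    intro t
    induction t with
    | zero => intro c h1 d h2; exact right d c h1 h2
    | succ t ih =>
      intro c h1 d h2
      by_cases hc : m ≤ c
      · exact right d c hc h2
      by_cases hd : D ≤ d
      · exact left c d hd h2
      have key : ∀ s d, d + s = D → T c d = 0 := by
        intro s
        induction s with
        | zero => intro d h; exact left c d (by lia) (by lia)
        | succ s ihs =>
          intro d h
          have := rel c d (by lia)
          rwa [ih (c + 1) (by lia) d (by lia), ihs (d + 1) (by lia), add_zero, add_zero] at this
      exact key (D - d) d (by lia)
  exact fun c d h => descend m c (by lia) d h

namespace IsCayleyFunctional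

variable {M : Type*} [AddCommGroup M] {r : ℕ} {G : ℕ → ℕ → ℕ → ℕ → M}

theorem corner_step (h : IsCayleyFunctional r G) {B : ℕ} (hB : B + 1 < r)
    (hxy : ∀ a b c, a + b + c + 2 = 2 * r → r ≤ a → B + 1 ≤ b → G a b c 0 = 0)
    (hxz : ∀ a b c, a + b + c + 2 = 2 * r → r ≤ a → B + 1 ≤ c → G a b c 0 = 0)
    (hyx : ∀ a b c, a + b + c + 2 = 2 * r → r ≤ b → B + 1 ≤ a → G a b c 0 = 0)
    (a b c : ℕ) (hs : a + b + c + 2 = 2 * r) (ha : r ≤ a) (hb : B ≤ b) : G a b c 0 = 0 := by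
  have aux : ∀ d a b c, a + b + c + d + 2 = 2 * r → B + 1 ≤ a → B + 1 ≤ b → c + d < r →
      G a b c d = 0 := by
    intro d
    induction d with
    | zero =>
      intro a b c hs ha hb hc
      by_cases h1 : r ≤ a
      · exact hxy a b c (by lia) h1 hb
      by_cases h2 : r ≤ b
      · exact hyx a b c (by lia) h2 ha
      exact h.zero a b c 0 (by lia) (by lia) (by lia) (by lia) (by lia) (by simp)
    | succ d ih =>
      intro a b c hs ha hb hc
      have := h.rel a b c d (by lia) (by lia)
      rwa [ih (a + 1) b c (by lia) (by lia) (by lia) (by lia),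
        ih a (b + 1) c (by lia) (by lia) (by lia) (by lia),
        ih a b (c + 1) (by lia) (by lia) (by lia) (by lia), zero_add, zero_add, zero_add] at this
  rcases hb.lt_or_eq with hb | rfl
  · exact hxy a b c hs ha hb
  by_cases hc : B + 1 ≤ c
  · exact hxz a B c hs ha hc
  obtain ⟨m, hm1, hm2, hm3, hm4⟩ : ∃ m, 0 < m ∧ m ≤ B + 1 ∧ m + B + 1 ≤ r ∧
      ∀ c, m ≤ c → B + 1 ≤ c ∨ r ≤ c + B + 1 :=
    ⟨min (B + 1) (r - B - 1), by lia, by lia, by lia, by lia⟩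
  have hT := pascal_array_eq_zero (D := r - B - 1) (m := m)
    (fun c d => G (2 * r - 2 - B - c - d) B c d) ?_ ?_ ?_ c 0 ?_
  · convert hT using 1
    congr 1
    lia
  · intro c d hcd
    have := h.rel (2 * r - 3 - B - c - d) B c d (by lia) (by lia)
    rw [aux d _ (B + 1) c (by lia) (by lia) (by lia) (by lia), add_zero] at this
    rwa [show 2 * r - 2 - B - c - d = 2 * r - 3 - B - c - d + 1 by lia,
      show 2 * r - 2 - B - (c + 1) - d = 2 * r - 3 - B - c - d by lia,
      show 2 * r - 2 - B - c - (d + 1) = 2 * r - 3 - B - c - d by lia]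
  · intro d hd1 hd2
    exact h.zero _ _ _ _ (by lia) (by lia) (by lia) (by lia) (by lia) (by simp)
  · intro c hc1 hc2
    by_cases h1 : r ≤ 2 * r - 2 - B - c - 0
    · exact hxz _ _ _ (by lia) h1 (by have := hm4 c hc1; lia)
    · exact h.zero _ _ _ _ (by lia) (by lia) (by lia) (by lia) (by lia) (by simp)
  · by_contra hlt
    have := hm4 c (by lia)
    lia

theorem corner (h : IsCayleyFunctional r G) (a b c : ℕ) (hs : a + b + c + 2 = 2 * r)
    (ha : r ≤ a) : G a b c 0 = 0 := by
  have key : ∀ t B, B + t + 1 = r → ∀ G : ℕ → ℕ → ℕ → ℕ → M, IsCayleyFunctional r G →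
      ∀ a b c, a + b + c + 2 = 2 * r → r ≤ a → B ≤ b → G a b c 0 = 0 := by
    intro t
    induction t with
    | zero => intro B hB G _ a b c hs ha hb; lia
    | succ t ih =>
      intro B hB G h
      have hi := ih (B + 1) (by lia)
      exact h.corner_step (by lia) (hi G h)
        (fun a b c hs ha hc => hi _ h.swap_right a c b (by lia) ha hc)
        (fun a b c hs hb ha => hi _ h.swap_left b a c (by lia) hb ha)
  exact key (r - 1) 0 (by lia) G h a b c hs ha (Nat.zero_le b)

theorem eq_zero (h : IsCayleyFunctional r G) (d : ℕ) (hd : d ≤ r) :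
    ∀ a b c, a + b + c + d + 2 = 2 * r → G a b c d = 0 := by
  induction d with
  | zero =>
    intro a b c hs
    by_cases ha : r ≤ a
    · exact h.corner a b c hs ha
    by_cases hb : r ≤ b
    · exact h.swap_left.corner b a c (by lia) hb
    by_cases hc : r ≤ c
    · exact h.swap_right.swap_left.corner c a b (by lia) hc
    exact h.zero a b c 0 hs (by lia) (by lia) (by lia) (by lia) (by simp)
  | succ d ih =>
    intro a b c hs
    have ih := ih (by lia)
    have := h.rel a b c d (by lia) (by lia)
    rwa [ih _ _ _ (by lia), ih _ _ _ (by lia), ih _ _ _ (by lia), zero_add, zero_add,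
      zero_add] at this

end IsCayleyFunctional

/-- Redefine a function of four exponents where the first exponent exceeds `r`, so that it kills
the multiples of the sum of the variables there. -/
def extendFirst {M : Type*} [AddCommGroup M] (r : ℕ) (g : ℕ → ℕ → ℕ → ℕ → M) :
    ℕ → ℕ → ℕ → ℕ → M
  | 0, b, c, d => g 0 b c d
  | a + 1, b, c, d =>
    if a < r then g (a + 1) b c d
    else -(extendFirst r g a (b + 1) c d + extendFirst r g a b (c + 1) d
      + extendFirst r g a b c (d + 1))

section Extend

variable {M : Type*} [AddCommGroup M] {r : ℕ} {g : ℕ → ℕ → ℕ → ℕ → M}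

theorem extendFirst_of_le {a : ℕ} (ha : a ≤ r) (b c d : ℕ) :
    extendFirst r g a b c d = g a b c d := by
  cases a with
  | zero => rfl
  | succ a => rw [extendFirst, if_pos (by lia)]

theorem extendFirst_rel {a b c d : ℕ} (h : a < r →
    g (a + 1) b c d + g a (b + 1) c d + g a b (c + 1) d + g a b c (d + 1) = 0) :
    extendFirst r g (a + 1) b c d + extendFirst r g a (b + 1) c d
      + extendFirst r g a b (c + 1) d + extendFirst r g a b c (d + 1) = 0 := by
  by_cases ha : a < r
  · simpa only [extendFirst_of_le (show a + 1 ≤ r from ha), extendFirst_of_le ha.le] using h ha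
  · rw [extendFirst, if_neg ha]; abel

theorem exists_isCayleyFunctional
    (rel : ∀ a b c d, a < r → b < r → c < r → d < r →
      g (a + 1) b c d + g a (b + 1) c d + g a b (c + 1) d + g a b c (d + 1) = 0)
    (zero : ∀ a b c d, a < r → b < r → c < r → d < r →
      (a = 0 ∨ b = 0 ∨ c = 0 ∨ d = 0) → g a b c d = 0) :
    ∃ G, IsCayleyFunctional r G ∧
      ∀ a b c d, a ≤ r → b ≤ r → c ≤ r → G a b c d = g a b c d := by
  let g₁ := extendFirst r g
  let g₂ := extendFirst r fun b a c d => g₁ a b c d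
  let g₃ := extendFirst r fun c a b d => g₂ b a c d
  have hg : ∀ a b c d, a ≤ r → b ≤ r → c ≤ r → g₃ c a b d = g a b c d := by
    intro a b c d ha hb hc
    simp only [g₃, g₂, g₁]
    rw [extendFirst_of_le hc, extendFirst_of_le hb, extendFirst_of_le ha]
  refine ⟨fun a b c d => g₃ c a b d, ⟨?_, ?_⟩, hg⟩
  · intro a b c d _ hd
    have := extendFirst_rel (r := r) (g := fun c a b d => g₂ b a c d) (a := c) (b := a) (c := b)
      (d := d) fun hc => by
        have := extendFirst_rel (r := r) (g := fun b a c d => g₁ a b c d) (a := b) (b := a) (c := c)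
          (d := d) fun hb => by
            have := extendFirst_rel (r := r) (g := g) (a := a) (b := b) (c := c) (d := d)
              fun ha => rel a b c d ha hb hc hd
            rw [← this]; simp only [g₁]; abel
        rw [← this]; simp only [g₂]; abel
    rw [← this]; simp only [g₃]; abel
  · intro a b c d _ ha hb hc hd h0
    rw [hg a b c d ha.le hb.le hc.le, zero a b c d ha hb hc hd h0]

end Extend

section Ring

variable {A : Type*} [CommRing A] {x y z w : A} {q : ℕ}

theorem pow_mul_eq_zero_of_cayley (hf : x * y * z + x * y * w + x * z * w + y * z * w = 0)
    (hx : x ^ q = 0) : x ^ (q - 1) * (y * z * w) = 0 := by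
  cases q with
  | zero =>
    have : (1 : A) = 0 := by simpa using hx
    rw [← one_mul (_ * _), this, zero_mul]
  | succ r =>
    rw [Nat.add_sub_cancel]
    linear_combination x ^ r * hf - (y * z + y * w + z * w) * hx

theorem monomial_eq_zero_of_cayley (hf : x * y * z + x * y * w + x * z * w + y * z * w = 0)
    (hx : x ^ q = 0) (hy : y ^ q = 0) (hz : z ^ q = 0) (hw : w ^ q = 0) {a b c d : ℕ}
    (hs : a + b + c + d = 2 * q) : x ^ a * y ^ b * z ^ c * w ^ d = 0 := by
  by_cases ha : q ≤ a
  · simp [pow_eq_zero_of_le ha hx]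
  by_cases hb : q ≤ b
  · simp [pow_eq_zero_of_le hb hy]
  by_cases hc : q ≤ c
  · simp [pow_eq_zero_of_le hc hz]
  by_cases hd : q ≤ d
  · simp [pow_eq_zero_of_le hd hw]
  obtain ⟨r, rfl⟩ : ∃ r, q = r + 1 := ⟨q - 1, by lia⟩
  let g : ℕ → ℕ → ℕ → ℕ → A :=
    fun a b c d => x ^ (r - a) * y ^ (r - b) * z ^ (r - c) * w ^ (r - d)
  have e : ∀ s, s < r → r - s = r - (s + 1) + 1 := by lia
  have rel : ∀ a b c d, a < r → b < r → c < r → d < r →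
      g (a + 1) b c d + g a (b + 1) c d + g a b (c + 1) d + g a b c (d + 1) = 0 := by
    intro a b c d ha hb hc hd
    simp only [g]
    rw [e a ha, e b hb, e c hc, e d hd]
    linear_combination x ^ (r - (a + 1)) * y ^ (r - (b + 1)) * z ^ (r - (c + 1))
      * w ^ (r - (d + 1)) * hf
  have zero : ∀ a b c d, a < r → b < r → c < r → d < r →
      (a = 0 ∨ b = 0 ∨ c = 0 ∨ d = 0) → g a b c d = 0 := by
    intro a b c d ha hb hc hd h0
    simp only [g]
    rcases h0 with rfl | rfl | rfl | rfl
    · have := pow_mul_eq_zero_of_cayley hf hx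
      simp only [Nat.add_sub_cancel, Nat.sub_zero] at this ⊢
      rw [e b hb, e c hc, e d hd]
      linear_combination y ^ (r - (b + 1)) * z ^ (r - (c + 1)) * w ^ (r - (d + 1)) * this
    · have := pow_mul_eq_zero_of_cayley (x := y) (y := x) (z := z) (w := w)
        (by linear_combination hf) hy
      simp only [Nat.add_sub_cancel, Nat.sub_zero] at this ⊢
      rw [e a ha, e c hc, e d hd]
      linear_combination x ^ (r - (a + 1)) * z ^ (r - (c + 1)) * w ^ (r - (d + 1)) * this
    · have := pow_mul_eq_zero_of_cayley (x := z) (y := x) (z := y) (w := w)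
        (by linear_combination hf) hz
      simp only [Nat.add_sub_cancel, Nat.sub_zero] at this ⊢
      rw [e a ha, e b hb, e d hd]
      linear_combination x ^ (r - (a + 1)) * y ^ (r - (b + 1)) * w ^ (r - (d + 1)) * this
    · have := pow_mul_eq_zero_of_cayley (x := w) (y := x) (z := y) (w := z)
        (by linear_combination hf) hw
      simp only [Nat.add_sub_cancel, Nat.sub_zero] at this ⊢
      rw [e a ha, e b hb, e c hc]
      linear_combination x ^ (r - (a + 1)) * y ^ (r - (b + 1)) * z ^ (r - (c + 1)) * this
  obtain ⟨G, hG, hGg⟩ := exists_isCayleyFunctional rel zero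
  have := hG.eq_zero (r - d) (by lia) (r - a) (r - b) (r - c) (by lia)
  rw [hGg _ _ _ _ (by lia) (by lia) (by lia)] at this
  simpa only [g, Nat.sub_sub_self (Nat.le_of_lt_succ (not_le.mp ha)),
    Nat.sub_sub_self (Nat.le_of_lt_succ (not_le.mp hb)),
    Nat.sub_sub_self (Nat.le_of_lt_succ (not_le.mp hc)),
    Nat.sub_sub_self (Nat.le_of_lt_succ (not_le.mp hd))] using this

theorem monomial_eq_zero_of_cayley_of_le
    (hf : x * y * z + x * y * w + x * z * w + y * z * w = 0)
    (hx : x ^ q = 0) (hy : y ^ q = 0) (hz : z ^ q = 0) (hw : w ^ q = 0) {a b c d : ℕ}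
    (hs : 2 * q ≤ a + b + c + d) : x ^ a * y ^ b * z ^ c * w ^ d = 0 := by
  obtain ⟨a', b', c', d', ha, hb, hc, hd, hs'⟩ : ∃ a' b' c' d', a' ≤ a ∧ b' ≤ b ∧ c' ≤ c ∧ d' ≤ d ∧
      a' + b' + c' + d' = 2 * q :=
    ⟨min a (2 * q), min b (2 * q - a), min c (2 * q - a - b), 2 * q - a - b - c,
      by lia, by lia, by lia, by lia, by lia⟩
  refine zero_dvd_iff.mp (monomial_eq_zero_of_cayley hf hx hy hz hw hs' ▸ ?_)
  gcongr

end Ring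

theorem mul_pow_mul_pow_notMem (k : Type*) [Field k] {q : ℕ} (hq : 1 < q) :
    (X 0 : MvPolynomial (Fin 4) k) * X 2 ^ (q - 1) * X 3 ^ (q - 1) ∉
      Ideal.span {(X 0 : MvPolynomial (Fin 4) k) * X 1 * X 2 + X 0 * X 1 * X 3
        + X 0 * X 2 * X 3 + X 1 * X 2 * X 3, X 0 ^ q, X 1 ^ q, X 2 ^ q, X 3 ^ q} := by
  intro hmem
  let s : Set (Fin 3 →₀ ℕ) := {Finsupp.single 0 2, Finsupp.single 1 q, Finsupp.single 2 q}
  let J : Ideal (MvPolynomial (Fin 3) k) := Ideal.span ((fun i => monomial i (1 : k)) '' s)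
  let φ : MvPolynomial (Fin 4) k →ₐ[k] MvPolynomial (Fin 3) k := aeval ![X 0, -X 0, X 1, X 2]
  have h0 : (X 0 : MvPolynomial (Fin 3) k) ^ 2 ∈ J :=
    Ideal.subset_span ⟨Finsupp.single 0 2, by simp [s], X_pow_eq_monomial.symm⟩
  have h1 : (X 1 : MvPolynomial (Fin 3) k) ^ q ∈ J :=
    Ideal.subset_span ⟨Finsupp.single 1 q, by simp [s], X_pow_eq_monomial.symm⟩
  have h2 : (X 2 : MvPolynomial (Fin 3) k) ^ q ∈ J :=
    Ideal.subset_span ⟨Finsupp.single 2 q, by simp [s], X_pow_eq_monomial.symm⟩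
  have h0q : (X 0 : MvPolynomial (Fin 3) k) ^ q ∈ J := J.pow_mem_of_pow_mem h0 hq
  have hle : Ideal.span {(X 0 : MvPolynomial (Fin 4) k) * X 1 * X 2 + X 0 * X 1 * X 3
      + X 0 * X 2 * X 3 + X 1 * X 2 * X 3, X 0 ^ q, X 1 ^ q, X 2 ^ q, X 3 ^ q} ≤ J.comap φ := by
    rw [Ideal.span_le]
    rintro p (rfl | rfl | rfl | rfl | rfl)
    · have : φ (X 0 * X 1 * X 2 + X 0 * X 1 * X 3 + X 0 * X 2 * X 3 + X 1 * X 2 * X 3) =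
          -(X 1 + X 2) * X 0 ^ 2 := by
        simp [φ]; ring
      simpa only [SetLike.mem_coe, Ideal.mem_comap, this] using J.mul_mem_left _ h0
    · simpa [φ] using h0q
    · have : φ (X 1 ^ q) = (-1) ^ q * X 0 ^ q := by
        simp [φ, neg_pow (X 0 : MvPolynomial (Fin 3) k) q]
      simpa only [SetLike.mem_coe, Ideal.mem_comap, this] using J.mul_mem_left _ h0q
    · simpa [φ] using h1
    · simpa [φ] using h2
  have hJ := hle hmem
  let m : Fin 3 →₀ ℕ := Finsupp.single 0 1 + Finsupp.single 1 (q - 1) + Finsupp.single 2 (q - 1)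
  have hm : φ (X 0 * X 2 ^ (q - 1) * X 3 ^ (q - 1)) = monomial m 1 := by
    have : φ (X 0 * X 2 ^ (q - 1) * X 3 ^ (q - 1)) = X 0 ^ 1 * X 1 ^ (q - 1) * X 2 ^ (q - 1) := by
      simp [φ]
    rw [this]
    simp only [m, X_pow_eq_monomial, monomial_mul, mul_one]
  rw [Ideal.mem_comap, hm, mem_ideal_span_monomial_image] at hJ
  obtain ⟨i, hi, hle⟩ := hJ m (by simp [mem_support_iff])
  rcases hi with rfl | rfl | rfl
  · have := hle 0
    simp [m] at this
  · have := hle 1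
    simp [m] at this
    lia
  · have := hle 2
    simp [m] at this
    lia

/-- **Socle degree for Cayley's cubic surface.**
Over any field `k` and for any integer `q > 1`, the socle degree of
`k[x,y,z,w]/(xyz + xyw + xzw + yzw, x^q, y^q, z^q, w^q)` equals `2q − 1`: some homogeneous
polynomial of degree `2q − 1` lies outside the ideal, while every homogeneous polynomial of
degree at least `2q` lies in it. -/
theorem socle_degree_cayley_cubic
    (k : Type*) [Field k] (q : ℕ) (hq : 1 < q) :
    (∃ g : MvPolynomial (Fin 4) k, g.IsHomogeneous (2 * q - 1) ∧
        g ∉ Ideal.span {(X 0 : MvPolynomial (Fin 4) k) * X 1 * X 2 + X 0 * X 1 * X 3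
              + X 0 * X 2 * X 3 + X 1 * X 2 * X 3,
            X 0 ^ q, X 1 ^ q, X 2 ^ q, X 3 ^ q}) ∧
      ∀ i : ℕ, 2 * q ≤ i → ∀ g : MvPolynomial (Fin 4) k, g.IsHomogeneous i →
        g ∈ Ideal.span {(X 0 : MvPolynomial (Fin 4) k) * X 1 * X 2 + X 0 * X 1 * X 3
              + X 0 * X 2 * X 3 + X 1 * X 2 * X 3,
            X 0 ^ q, X 1 ^ q, X 2 ^ q, X 3 ^ q} := by
  refine ⟨⟨_, ?_, mul_pow_mul_pow_notMem k hq⟩, fun i hi g hg => ?_⟩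
  · have := ((isHomogeneous_X k (0 : Fin 4)).mul
      (isHomogeneous_X_pow (R := k) (2 : Fin 4) (q - 1))).mul
        (isHomogeneous_X_pow (R := k) (3 : Fin 4) (q - 1))
    convert this using 1
    lia
  · set I := Ideal.span {(X 0 : MvPolynomial (Fin 4) k) * X 1 * X 2 + X 0 * X 1 * X 3
              + X 0 * X 2 * X 3 + X 1 * X 2 * X 3,
            X 0 ^ q, X 1 ^ q, X 2 ^ q, X 3 ^ q}
    have gen : ∀ p ∈ ({(X 0 : MvPolynomial (Fin 4) k) * X 1 * X 2 + X 0 * X 1 * X 3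
              + X 0 * X 2 * X 3 + X 1 * X 2 * X 3,
            X 0 ^ q, X 1 ^ q, X 2 ^ q, X 3 ^ q} : Set (MvPolynomial (Fin 4) k)),
        Ideal.Quotient.mk I p = 0 :=
      fun p hp => Ideal.Quotient.eq_zero_iff_mem.mpr (Ideal.subset_span hp)
    rw [g.as_sum]
    refine I.sum_mem fun m hm => ?_
    have hdeg : m 0 + m 1 + m 2 + m 3 = i := by
      rw [← Fin.sum_univ_four, ← Finsupp.degree_eq_sum]
      rw [Finsupp.degree_eq_weight_one]
      exact hg (mem_support_iff.mp hm)
    rw [monomial_eq, Finsupp.prod_fintype _ _ (by simp), Fin.prod_univ_four]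
    refine I.mul_mem_left _ (Ideal.Quotient.eq_zero_iff_mem.mp ?_)
    simp only [map_mul, map_pow]
    refine monomial_eq_zero_of_cayley_of_le (q := q) ?_ ?_ ?_ ?_ ?_ (by lia)
    · simpa only [map_add, map_mul] using gen _ (Or.inl rfl)
    · simpa only [map_pow] using gen (X 0 ^ q) (by simp)
    · simpa only [map_pow] using gen (X 1 ^ q) (by simp)
    · simpa only [map_pow] using gen (X 2 ^ q) (by simp)
    · simpa only [map_pow] using gen (X 3 ^ q) (by simp)
end

section
/- For every integer k ≥ 1, the determinant of the k×k Hankel matrix whose (i,j)-entry (for 0 ≤ i,j ≤ k−1) is the Legendre polynomial P_{i+j} satisfies det(P_{i+j})_{0≤i,j≤k−1} = 2^{−(k−1)²}·(t² − 1)^{k(k−1)/2} as an identity in ℝ[t]. -/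
open Polynomial

/-- The `n`-th Legendre polynomial, defined by Rodrigues' formula
`P_n = (1/(2ⁿ·n!))·(d/dt)ⁿ[(t² − 1)ⁿ]`. -/
noncomputable def legendre (n : ℕ) : Polynomial ℝ :=
  ((1 : ℝ) / (2 ^ n * n.factorial)) • derivative^[n] ((X ^ 2 - 1) ^ n)

theorem coeff_pow_quadratic_eq_zero {R : Type*} [CommRing R] (s q : R) {i n : ℕ} (h : 2 * i < n) :
    ((X ^ 2 + C s * X + C q) ^ i).coeff n = 0 := by
  have hdeg : (X ^ 2 + C s * X + C q).natDegree ≤ 2 := by compute_degree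
  exact coeff_eq_zero_of_natDegree_lt ((natDegree_pow_le_of_le i hdeg).trans_lt (by lia))

theorem coeff_add_two_pow_succ_quadratic {R : Type*} [CommRing R] (s q : R) (i n : ℕ) :
    ((X ^ 2 + C s * X + C q) ^ (i + 1)).coeff (n + 2) =
      ((X ^ 2 + C s * X + C q) ^ i).coeff n + s * ((X ^ 2 + C s * X + C q) ^ i).coeff (n + 1) +
        q * ((X ^ 2 + C s * X + C q) ^ i).coeff (n + 2) := by
  rw [pow_succ, mul_add, mul_add, coeff_add, coeff_add, coeff_mul_X_pow, ← mul_assoc,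
    coeff_mul_X, coeff_mul_C, coeff_mul_C]
  ring

theorem coeff_pow_quadratic_symm {R : Type*} [CommRing R] (s q : R) (i : ℕ) :
    ∀ a m : ℕ, a + m = i → ((X ^ 2 + C s * X + C q) ^ i).coeff a =
      q ^ m * ((X ^ 2 + C s * X + C q) ^ i).coeff (i + m) := by
  induction i with
  | zero =>
    intro a m h
    obtain ⟨rfl, rfl⟩ : a = 0 ∧ m = 0 := by lia
    simp
  | succ i ih =>
    rintro a (_ | m) h
    · simp [← h]
    have hr := coeff_add_two_pow_succ_quadratic s q i (i + m)
    rw [show i + 1 + (m + 1) = i + m + 2 by ring, hr]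
    match a with
    | 0 =>
      obtain rfl : m = i := by lia
      have h0 := ih 0 m (by lia)
      rw [coeff_pow_quadratic_eq_zero s q (i := m) (n := m + m + 1) (by lia),
        coeff_pow_quadratic_eq_zero s q (i := m) (n := m + m + 2) (by lia), pow_succ,
        mul_coeff_zero, h0]
      simp
      ring
    | 1 =>
      have h0 := ih 0 (m + 1) (by lia)
      have h1 := ih 1 m (by lia)
      rw [coeff_pow_quadratic_eq_zero s q (i := i) (n := i + m + 2) (by lia), pow_succ (_ + _),
        mul_add, mul_add, coeff_add, coeff_add, ← mul_assoc, coeff_mul_X, coeff_mul_C, coeff_mul_C,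
        h0, h1, coeff_mul_X_pow']
      simp
      ring_nf
    | a + 2 =>
      have h0 := ih a (m + 2) (by lia)
      have h1 := ih (a + 1) (m + 1) (by lia)
      have h2 := ih (a + 2) m (by lia)
      rw [coeff_add_two_pow_succ_quadratic, h0, h1, h2]
      ring_nf

theorem coeff_pow_add_quadratic {R : Type*} [CommRing R] (s q : R) {i j n : ℕ} (hi : i ≤ n)
    (hj : j ≤ n) :
    ((X ^ 2 + C s * X + C q) ^ (i + j)).coeff (i + j) =
      ((X ^ 2 + C s * X + C q) ^ i).coeff i * ((X ^ 2 + C s * X + C q) ^ j).coeff j +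
      ∑ m ∈ Finset.range n, 2 * q ^ (m + 1) *
        (((X ^ 2 + C s * X + C q) ^ i).coeff (i + (m + 1)) *
          ((X ^ 2 + C s * X + C q) ^ j).coeff (j + (m + 1))) := by
  set G := X ^ 2 + C s * X + C q with hG
  have extend : ∀ l ≤ n, (∀ m, l ≤ m → (G ^ i).coeff (i + (m + 1)) *
      (G ^ j).coeff (j + (m + 1)) = 0) →
      ∑ m ∈ Finset.range l, q ^ (m + 1) * ((G ^ i).coeff (i + (m + 1)) *
        (G ^ j).coeff (j + (m + 1))) =
      ∑ m ∈ Finset.range n, q ^ (m + 1) * ((G ^ i).coeff (i + (m + 1)) *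
        (G ^ j).coeff (j + (m + 1))) := by
    intro l hl h
    refine Finset.sum_subset (Finset.range_mono hl) fun m _ hm => ?_
    rw [h m (by simpa using hm), mul_zero]
  rw [pow_add, coeff_mul, Finset.Nat.sum_antidiagonal_eq_sum_range_succ
    (fun a b => (G ^ i).coeff a * (G ^ j).coeff b), show (i + j).succ = i + (j + 1) by lia,
    Finset.sum_range_add, Finset.sum_range_succ', ← Finset.sum_range_reflect]
  have h1 : ∀ m ∈ Finset.range i, (G ^ i).coeff (i - 1 - m) * (G ^ j).coeff (i + j - (i - 1 - m)) =
      q ^ (m + 1) * ((G ^ i).coeff (i + (m + 1)) * (G ^ j).coeff (j + (m + 1))) := by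
    intro m hm
    rw [Finset.mem_range] at hm
    rw [coeff_pow_quadratic_symm s q i (i - 1 - m) (m + 1) (by lia),
      show i + j - (i - 1 - m) = j + (m + 1) by lia, mul_assoc]
  have h2 : ∀ m ∈ Finset.range j, (G ^ i).coeff (i + (m + 1)) *
      (G ^ j).coeff (i + j - (i + (m + 1))) =
      q ^ (m + 1) * ((G ^ i).coeff (i + (m + 1)) * (G ^ j).coeff (j + (m + 1))) := by
    intro m hm
    rw [Finset.mem_range] at hm
    rw [coeff_pow_quadratic_symm s q j (i + j - (i + (m + 1))) (m + 1) (by lia)]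
    ring
  rw [Finset.sum_congr rfl h1, Finset.sum_congr rfl h2,
    extend i hi fun m hm => by rw [hG, coeff_pow_quadratic_eq_zero s q (by lia), zero_mul],
    extend j hj fun m hm => by
      rw [hG, coeff_pow_quadratic_eq_zero (i := j) s q (by lia), mul_zero]]
  simp only [mul_assoc, ← Finset.mul_sum]
  simp
  ring

theorem coeff_two_mul_pow_quadratic {R : Type*} [CommRing R] (s q : R) (i : ℕ) :
    ((X ^ 2 + C s * X + C q) ^ i).coeff (i + i) = 1 := by
  have hdeg : (X ^ 2 + C s * X + C q).natDegree ≤ 2 := by compute_degree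
  rw [← mul_two, coeff_pow_of_natDegree_le hdeg]
  simp

theorem eval_legendre (n : ℕ) (t : ℝ) :
    (legendre n).eval t =
      (1 / 2) ^ n * ((X ^ 2 + C (2 * t) * X + C (t ^ 2 - 1)) ^ n).coeff n := by
  have htaylor : X ^ 2 + C (2 * t) * X + C (t ^ 2 - 1) = taylor t (X ^ 2 - 1 : ℝ[X]) := by
    simp [taylor_apply, C_ofNat]
    ring
  have hfact : (n.factorial : ℝ) ≠ 0 := by positivity
  rw [htaylor, ← taylor_pow, taylor_coeff, legendre, ← factorial_smul_hasseDeriv, eval_smul,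
    LinearMap.smul_apply, nsmul_eq_mul, eval_mul, eval_natCast, smul_eq_mul, one_div_pow]
  field_simp

theorem det_eval_legendre (n : ℕ) (t : ℝ) :
    (Matrix.of fun i j : Fin (n + 1) => (legendre (i.1 + j.1)).eval t).det =
      (1 / 2) ^ n ^ 2 * (t ^ 2 - 1) ^ ((n + 1) * n / 2) := by
  set q := t ^ 2 - 1 with hq
  let B : Matrix (Fin (n + 1)) (Fin (n + 1)) ℝ := Matrix.of fun i m =>
    (1 / 2) ^ i.1 * ((X ^ 2 + C (2 * t) * X + C q) ^ i.1).coeff (i.1 + m.1)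
  let w : Fin (n + 1) → ℝ := Fin.cons 1 fun m => 2 * q ^ (m.1 + 1)
  have hfactor : (Matrix.of fun i j : Fin (n + 1) => (legendre (i.1 + j.1)).eval t) =
      B * Matrix.diagonal w * B.transpose := by
    ext i j
    rw [Matrix.mul_apply, Fin.sum_univ_succ]
    simp only [Matrix.mul_diagonal, Matrix.transpose_apply, Matrix.of_apply, B, w, Fin.cons_zero,
      Fin.cons_succ, Fin.val_zero, Fin.val_succ, add_zero]
    rw [eval_legendre, ← hq, coeff_pow_add_quadratic (2 * t) q (Fin.is_le i) (Fin.is_le j), mul_add,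
      Finset.mul_sum, Finset.sum_range]
    congr 1
    · ring
    · exact Finset.sum_congr rfl fun m _ => by ring
  have hB : B.det = ∏ i : Fin (n + 1), (1 / 2 : ℝ) ^ i.1 := by
    rw [Matrix.det_of_isLowerTriangular]
    · exact Finset.prod_congr rfl fun i _ => by
        simp only [B, Matrix.of_apply, coeff_two_mul_pow_quadratic, mul_one]
    · intro i m him
      have him : i.1 < m.1 := him
      simp only [B, Matrix.of_apply,
        coeff_pow_quadratic_eq_zero (2 * t) q (show 2 * i.1 < i.1 + m.1 by lia), mul_zero]
  have hw : ∏ m, w m = 2 ^ n * q ^ ((n + 1) * n / 2) := by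
    have hgauss : ∑ m ∈ Finset.range n, (m + 1) = (n + 1) * n / 2 := by
      have h := Finset.sum_range_id (n + 1)
      rwa [Finset.sum_range_succ', add_zero, Nat.add_sub_cancel] at h
    rw [Fin.prod_univ_succ]
    simp only [w, Fin.cons_zero, Fin.cons_succ, one_mul]
    rw [← Finset.prod_range fun m => 2 * q ^ (m + 1), Finset.prod_mul_distrib,
      Finset.prod_pow_eq_pow_sum, hgauss]
    simp
  have hpow : ((1 / 2 : ℝ) ^ ∑ i ∈ Finset.range (n + 1), i) ^ 2 * 2 ^ n = (1 / 2) ^ n ^ 2 := by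
    rw [← pow_mul, Finset.sum_range_id_mul_two, Nat.add_sub_cancel, add_mul, one_mul, pow_add,
      mul_assoc, ← mul_pow, sq n]
    norm_num
  rw [hfactor, Matrix.det_mul, Matrix.det_mul, Matrix.det_transpose, Matrix.det_diagonal, hB, hw,
    ← Finset.prod_range fun i => (1 / 2 : ℝ) ^ i, Finset.prod_pow_eq_pow_sum, ← hpow]
  ring

/-- **Geronimus' formula.** For every `k ≥ 1`, the Hankel determinant of Legendre
polynomials satisfies `det(P_{i+j})_{0≤i,j≤k−1} = 2^{−(k−1)²}·(t² − 1)^{k(k−1)/2}`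
in `ℝ[t]`. -/
theorem hankel_det_legendre (k : ℕ) (hk : 1 ≤ k) :
    Matrix.det (Matrix.of fun i j : Fin k => legendre (i.1 + j.1)) =
      C ((2 : ℝ) ^ (-(((k - 1) ^ 2 : ℕ) : ℤ))) * (X ^ 2 - 1) ^ (k * (k - 1) / 2) := by
  obtain ⟨n, rfl⟩ : ∃ n, k = n + 1 := ⟨k - 1, by lia⟩
  refine Polynomial.funext fun t => ?_
  have hdet := RingHom.map_det (evalRingHom t)
    (Matrix.of fun i j : Fin (n + 1) => legendre (i.1 + j.1))
  rw [coe_evalRingHom] at hdet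
  rw [hdet]
  refine (det_eval_legendre n t).trans ?_
  rw [Nat.add_sub_cancel, zpow_neg, zpow_natCast]
  simp
end

section
/- For every real number t > 1 and every n ∈ ℕ, the value of the n-th Legendre polynomial at t is given by P_n(t) = (1/π) ∫₀^π (t + √(t² − 1)·cos α)ⁿ dα. -/
open Polynomial

/-- The value of the `n`-th Legendre polynomial at `t` as a Taylor coefficient. -/
theorem two_pow_mul_legendre_eval (t : ℝ) (n : ℕ) :
    2 ^ n * (legendre n).eval t = (((X + C t) ^ 2 - 1 : ℝ[X]) ^ n).coeff n := by
  have h : (((X + C t) ^ 2 - 1 : ℝ[X]) ^ n) = taylor t ((X ^ 2 - 1) ^ n) := by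
    simp [taylor_apply]
  rw [h, taylor_coeff, legendre, ← factorial_smul_hasseDeriv]
  have hn : (n.factorial : ℝ) ≠ 0 := by positivity
  simp [eval_smul]
  field_simp

/-- Orthogonality of the exponentials `α ↦ exp (i k α)` on `[-π, π]`. -/
theorem integral_cexp_pow_mul_cexp_neg_pow (k n : ℕ) :
    ∫ α in (-Real.pi)..Real.pi,
      Complex.exp (α * Complex.I) ^ k * Complex.exp (-(α * Complex.I)) ^ n =
        if k = n then 2 * (Real.pi : ℂ) else 0 := by
  split_ifs with h
  · subst h
    simp [← mul_pow, ← Complex.exp_add]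
    ring
  · have hc : ((k : ℂ) - n) * Complex.I ≠ 0 :=
      mul_ne_zero (sub_ne_zero.mpr (by exact_mod_cast h)) Complex.I_ne_zero
    have hf : ∀ α : ℝ, Complex.exp (α * Complex.I) ^ k * Complex.exp (-(α * Complex.I)) ^ n =
        Complex.exp (((k : ℂ) - n) * Complex.I * α) := fun α => by
      rw [← Complex.exp_nat_mul, ← Complex.exp_nat_mul, ← Complex.exp_add]
      ring_nf
    simp_rw [hf]
    rw [integral_exp_mul_complex hc, div_eq_zero_iff, sub_eq_zero]
    left
    rw [Complex.exp_eq_exp_iff_exists_int]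
    exact ⟨k - n, by push_cast; ring⟩

/-- Cauchy's formula for the coefficients of a polynomial, on a circle centred at `0`. -/
theorem integral_aeval_circle_mul_cexp_neg_pow (p : ℝ[X]) (s : ℝ) (n : ℕ) :
    ∫ α in (-Real.pi)..Real.pi,
      aeval (s * Complex.exp (α * Complex.I)) p * Complex.exp (-(α * Complex.I)) ^ n =
        2 * Real.pi * s ^ n * p.coeff n := by
  induction p using Polynomial.induction_on' with
  | add p q hp hq =>
    simp only [map_add, add_mul]
    rw [intervalIntegral.integral_add, hp, hq]
    · simp only [coeff_add, Complex.ofReal_add]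
      ring
    all_goals
      refine Continuous.intervalIntegrable ?_ _ _
      refine Continuous.mul ((Polynomial.continuous_aeval _).comp ?_) ?_ <;> fun_prop
  | monomial k a =>
    simp only [aeval_monomial, mul_pow, Complex.coe_algebraMap, mul_assoc,
      intervalIntegral.integral_const_mul, integral_cexp_pow_mul_cexp_neg_pow, coeff_monomial]
    split_ifs with h
    · subst h
      ring
    · simp

/-- The integral over a period of an expression in `cos` is twice the integral over `[0, π]`. -/
theorem integral_comp_cos_neg_pi_pi {f : ℝ → ℝ} (hf : Continuous f) :
    ∫ α in (-Real.pi)..Real.pi, f (Real.cos α) = 2 * ∫ α in (0 : ℝ)..Real.pi, f (Real.cos α) := by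
  have hi : ∀ a b : ℝ, IntervalIntegrable (fun α => f (Real.cos α)) MeasureTheory.volume a b :=
    fun a b => (hf.comp Real.continuous_cos).intervalIntegrable a b
  rw [← intervalIntegral.integral_add_adjacent_intervals (hi _ 0) (hi _ _), two_mul]
  congr 1
  simpa using intervalIntegral.integral_comp_neg (a := -Real.pi) (b := 0)
    (fun α => f (Real.cos α))

/-- **Integral representation of Legendre polynomials.** For every real `t > 1` and every
`n ∈ ℕ`, `P_n(t) = (1/π) ∫₀^π (t + √(t² − 1)·cos α)ⁿ dα`. -/
theorem legendre_eval_eq_integral (t : ℝ) (ht : 1 < t) (n : ℕ) :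
    (legendre n).eval t =
      (1 / Real.pi) * ∫ α in (0 : ℝ)..Real.pi,
        (t + Real.sqrt (t ^ 2 - 1) * Real.cos α) ^ n := by
  have hpos : 0 < t ^ 2 - 1 := by nlinarith
  set s := Real.sqrt (t ^ 2 - 1)
  have hs : s ≠ 0 := (Real.sqrt_pos.mpr hpos).ne'
  have hs2 : (s : ℂ) ^ 2 = t ^ 2 - 1 := by exact_mod_cast Real.sq_sqrt hpos.le
  have hint : ∀ α : ℝ,
      aeval (s * Complex.exp (α * Complex.I)) (((X + C t) ^ 2 - 1 : ℝ[X]) ^ n) *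
        Complex.exp (-(α * Complex.I)) ^ n =
      ((2 * s) ^ n : ℝ) * ((t + s * Real.cos α) ^ n : ℝ) := fun α => by
    have he : Complex.exp (α * Complex.I) * Complex.exp (-(α * Complex.I)) = 1 := by
      rw [← Complex.exp_add, add_neg_cancel, Complex.exp_zero]
    have hcos : (Real.cos α : ℂ) =
        (Complex.exp (α * Complex.I) + Complex.exp (-(α * Complex.I))) / 2 := by
      rw [Complex.ofReal_cos, Complex.cos, neg_mul]
    simp only [map_pow, map_sub, map_add, aeval_X, aeval_C, map_one, Complex.coe_algebraMap,
      Complex.ofReal_pow, Complex.ofReal_add, Complex.ofReal_mul, ← mul_pow, hcos]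
    congr 1
    push_cast
    linear_combination (s ^ 2 * Complex.exp (α * Complex.I) + 2 * s * t) * he
      - Complex.exp (-(α * Complex.I)) * hs2
  have key := integral_aeval_circle_mul_cexp_neg_pow (((X + C t) ^ 2 - 1 : ℝ[X]) ^ n) s n
  simp_rw [hint] at key
  rw [intervalIntegral.integral_const_mul, intervalIntegral.integral_ofReal,
    integral_comp_cos_neg_pi_pi (f := fun x => (t + s * x) ^ n) (by fun_prop),
    ← two_pow_mul_legendre_eval] at key
  norm_cast at key
  push_cast [mul_pow] at key
  have hpi := Real.pi_ne_zero
  field_simp at key ⊢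
  exact key.symm
end

section
/- Let (Q_n)_{n∈ℕ} be the unique sequence of polynomials in ℝ[t] satisfying Q₀ = 1 and Σ_{i=0}^{n} Q_i·P_{n−i} = 0 for all n ≥ 1, where P_m denotes the m-th Legendre polynomial (so the Q_n are the coefficients of the power series expansion of √(1 − 2tx + x²)). Then for every integer k ≥ 1, the determinant of the k×k Hankel matrix whose (i,j)-entry (for 0 ≤ i,j ≤ k−1) is Q_{i+j+2} satisfies det(Q_{i+j+2})_{0≤i,j≤k−1} = (−1)ᵏ·2^{−k²}·(t² − 1)^{k(k+1)/2} as an identity in ℝ[t]. -/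
open Polynomial

section LegendreRecurrence

/-- The derivative of `(t² - 1)ⁿ⁺¹`. -/
theorem derivative_X_sq_sub_one_pow (n : ℕ) :
    derivative ((X ^ 2 - 1 : ℝ[X]) ^ (n + 1)) =
      (2 * (n + 1) : ℝ[X]) * (X * (X ^ 2 - 1) ^ n) := by
  simp only [derivative_pow, derivative_sub, derivative_X, derivative_one, map_natCast,
    Nat.add_sub_cancel]
  push_cast
  ring

theorem iterate_derivative_two_mul_succ_mul (c k : ℕ) (p : ℝ[X]) :
    derivative^[k] ((2 * (c + 1) : ℝ[X]) * p) = (2 * (c + 1) : ℝ[X]) * derivative^[k] p := by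
  have h : (2 * (c + 1) : ℝ[X]) = ((2 * (c + 1) : ℕ) : ℝ[X]) := by push_cast; ring
  rw [h, iterate_derivative_natCast_mul]

theorem iterate_derivative_X_mul (n : ℕ) (p : ℝ[X]) :
    derivative^[n] (X * p) = X * derivative^[n] p + n • derivative^[n - 1] p := by
  rw [mul_comm, iterate_derivative_mul_X, mul_comm]

theorem iterate_derivative_rodrigues_succ (n : ℕ) :
    derivative^[n + 1] ((X ^ 2 - 1 : ℝ[X]) ^ (n + 1)) =
      (2 * (n + 1) : ℝ[X]) * (X * derivative^[n] ((X ^ 2 - 1 : ℝ[X]) ^ n) +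
        (n : ℝ[X]) * derivative^[n - 1] ((X ^ 2 - 1 : ℝ[X]) ^ n)) := by
  rw [Function.iterate_succ_apply, derivative_X_sq_sub_one_pow,
    iterate_derivative_two_mul_succ_mul, iterate_derivative_X_mul, nsmul_eq_mul]

theorem iterate_derivative_rodrigues_pred (n : ℕ) :
    (n + 2 : ℝ[X]) * derivative^[n] ((X ^ 2 - 1 : ℝ[X]) ^ (n + 1)) =
      (2 * (n + 1) : ℝ[X]) * ((X ^ 2 - 1 : ℝ[X]) * derivative^[n] ((X ^ 2 - 1 : ℝ[X]) ^ n) +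
        (n : ℝ[X]) * X * derivative^[n - 1] ((X ^ 2 - 1 : ℝ[X]) ^ n)) := by
  rcases n with _ | n
  · simp
  set u : ℝ[X] := (X ^ 2 - 1 : ℝ[X]) ^ (n + 1) with hu
  have h₁ : derivative^[n + 1] ((X ^ 2 - 1 : ℝ[X]) ^ (n + 1 + 1)) =
      (2 * (n + 1 + 1) : ℝ[X]) * (X * derivative^[n] u + (n : ℝ[X]) * derivative^[n - 1] u) := by
    rw [Function.iterate_succ_apply, derivative_X_sq_sub_one_pow,
      iterate_derivative_two_mul_succ_mul, iterate_derivative_X_mul, nsmul_eq_mul]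
    push_cast
    rfl
  have h₂ : derivative^[n + 1] ((X ^ 2 - 1 : ℝ[X]) ^ (n + 1 + 1)) =
      (X ^ 2 - 1 : ℝ[X]) * derivative^[n + 1] u + (2 * (n + 1) : ℝ[X]) * X * derivative^[n] u +
        ((n + 1) * n : ℝ[X]) * derivative^[n - 1] u := by
    have : (X ^ 2 - 1 : ℝ[X]) ^ (n + 1 + 1) = X * (X * u) - u := by rw [hu]; ring
    rw [this, iterate_derivative_sub, iterate_derivative_X_mul, iterate_derivative_X_mul,
      Nat.add_sub_cancel, iterate_derivative_X_mul]
    simp only [nsmul_eq_mul]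
    push_cast
    ring
  simp only [Nat.add_sub_cancel]
  push_cast
  linear_combination (2 * (n + 2) : ℝ[X]) * h₂ - (n + 1 : ℝ[X]) * h₁

theorem iterate_derivative_rodrigues_recurrence (n : ℕ) :
    derivative^[n + 2] ((X ^ 2 - 1 : ℝ[X]) ^ (n + 2)) =
      (2 * (2 * n + 3) : ℝ[X]) * X * derivative^[n + 1] ((X ^ 2 - 1 : ℝ[X]) ^ (n + 1)) -
        (4 * (n + 1) ^ 2 : ℝ[X]) * derivative^[n] ((X ^ 2 - 1 : ℝ[X]) ^ n) := by
  have h₁ := iterate_derivative_rodrigues_succ n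
  have h₂ := iterate_derivative_rodrigues_succ (n + 1)
  have h₃ := iterate_derivative_rodrigues_pred n
  simp only [Nat.add_sub_cancel] at h₂
  push_cast at h₂
  linear_combination h₂ + 2 * (n + 1 : ℝ[X]) * h₃ - 2 * (n + 1 : ℝ[X]) * X * h₁

theorem legendre_zero : legendre 0 = 1 := by
  simp [legendre]

theorem legendre_one : legendre 1 = X := by
  have h : derivative^[1] ((X ^ 2 - 1 : ℝ[X]) ^ 1) = (2 : ℝ) • X := by
    rw [Function.iterate_one, pow_one, derivative_sub, derivative_X_sq, derivative_one, sub_zero,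
      smul_eq_C_mul]
  rw [legendre, h, smul_smul]
  norm_num

/-- Bonnet's three-term recurrence. -/
theorem legendre_recurrence (n : ℕ) :
    (n + 2 : ℝ[X]) * legendre (n + 2) =
      (2 * n + 3 : ℝ[X]) * X * legendre (n + 1) - (n + 1 : ℝ[X]) * legendre n := by
  have hc : ∀ m : ℕ, derivative^[m] ((X ^ 2 - 1 : ℝ[X]) ^ m) =
      (2 ^ m * m.factorial : ℝ[X]) * legendre m := by
    intro m
    have : (2 ^ m * m.factorial : ℝ[X]) = C (2 ^ m * m.factorial : ℝ) := by
      simp only [C_mul, C_pow, C_ofNat, C_eq_natCast]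
    rw [this, legendre, ← smul_eq_C_mul, smul_smul, mul_one_div_cancel (by positivity), one_smul]
  have h := iterate_derivative_rodrigues_recurrence n
  simp only [hc] at h
  rw [Nat.factorial_succ, Nat.factorial_succ] at h
  push_cast at h
  have hne : (2 ^ (n + 2) * (n + 1) * n.factorial : ℝ[X]) ≠ 0 := by
    exact_mod_cast (by positivity : 2 ^ (n + 2) * (n + 1) * n.factorial ≠ 0)
  apply mul_left_cancel₀ hne
  linear_combination h

end LegendreRecurrence

section GeneratingFunction

open scoped PowerSeries in
/-- A sequence satisfying Bonnet's recurrence has generating function `(1 - 2tx + x²)^(-1/2)`. -/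
theorem mk_sq_mul_eq_one_of_recurrence {R : Type*} [CommRing R] [IsAddTorsionFree R] {t : R}
    {p : ℕ → R} (h₀ : p 0 = 1) (h₁ : p 1 = t)
    (h : ∀ n : ℕ, (n + 2 : R) * p (n + 2) = (2 * n + 3) * t * p (n + 1) - (n + 1) * p n) :
    (PowerSeries.mk p) ^ 2 * (1 - 2 * PowerSeries.C t * PowerSeries.X + PowerSeries.X ^ 2) = 1 := by
  set y := PowerSeries.mk p with hy
  have h2 : d⁄dX R (2 : PowerSeries R) = 0 := by
    exact_mod_cast (d⁄dX R).map_natCast 2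
  have hode : (1 - 2 * PowerSeries.C t * PowerSeries.X + PowerSeries.X ^ 2) * d⁄dX R y =
      (PowerSeries.C t - PowerSeries.X) * y := by
    have e₁ : (1 - 2 * PowerSeries.C t * PowerSeries.X + PowerSeries.X ^ 2) * d⁄dX R y =
        d⁄dX R y - PowerSeries.X * (PowerSeries.C (2 * t) * d⁄dX R y) +
          PowerSeries.X * (PowerSeries.X * d⁄dX R y) := by
      rw [map_mul, map_ofNat]
      ring
    rw [e₁, sub_mul]
    ext1 n
    rcases n with _ | _ | n
    · simp only [map_add, map_sub, PowerSeries.coeff_zero_X_mul, PowerSeries.coeff_C_mul,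
        PowerSeries.coeff_derivative, hy, PowerSeries.coeff_mk, h₀, h₁]
      push_cast
      ring
    · have := h 0
      simp only [map_add, map_sub, PowerSeries.coeff_zero_X_mul, PowerSeries.coeff_succ_X_mul,
        PowerSeries.coeff_C_mul, PowerSeries.coeff_derivative, hy, PowerSeries.coeff_mk,
        zero_add, h₀, h₁] at this ⊢
      push_cast at this ⊢
      linear_combination this
    · have := h (n + 1)
      simp only [map_add, map_sub, PowerSeries.coeff_succ_X_mul, PowerSeries.coeff_C_mul,
        PowerSeries.coeff_derivative, hy, PowerSeries.coeff_mk] at this ⊢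
      push_cast at this ⊢
      linear_combination this
  apply PowerSeries.derivative.ext
  · simp only [Derivation.leibniz, Derivation.leibniz_pow, map_add, map_sub,
      PowerSeries.derivative_C, h2, PowerSeries.derivative_X, Derivation.map_one_eq_zero,
      smul_eq_mul, nsmul_eq_mul]
    push_cast
    linear_combination 2 * y * hode
  · simp [hy, h₀]

/-- The generating function of the Legendre polynomials is `(1 - 2tx + x²)^(-1/2)`. -/
theorem legendre_generating_function :
    (PowerSeries.mk legendre) ^ 2 *
      (1 - 2 * PowerSeries.C (X : ℝ[X]) * PowerSeries.X + PowerSeries.X ^ 2) = 1 :=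
  mk_sq_mul_eq_one_of_recurrence legendre_zero legendre_one legendre_recurrence

end GeneratingFunction

section Hankel

variable {R : Type*} [CommRing R]

/-- The Riordan array of the `J`-fraction `G = 1 + b x G + l x² G²`: its `(n, k)` entry is the
coefficient of `xⁿ` in `xᵏ Gᵏ⁺¹`. -/
noncomputable def stieltjesArray (G : PowerSeries R) (n k : ℕ) : R :=
  PowerSeries.coeff n (PowerSeries.X ^ k * G ^ (k + 1))

theorem stieltjesArray_of_lt (G : PowerSeries R) {n k : ℕ} (h : n < k) :
    stieltjesArray G n k = 0 := by
  rw [stieltjesArray, PowerSeries.coeff_X_pow_mul', if_neg (by omega)]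

theorem stieltjesArray_self {G : PowerSeries R} (hG : PowerSeries.constantCoeff G = 1) (n : ℕ) :
    stieltjesArray G n n = 1 := by
  simp [stieltjesArray, PowerSeries.coeff_X_pow_mul', hG]

theorem stieltjesArray_zero_right (G : PowerSeries R) (n : ℕ) :
    stieltjesArray G n 0 = PowerSeries.coeff n G := by
  simp [stieltjesArray]

variable {G : PowerSeries R} {b l : R}
  (hG : G = 1 + PowerSeries.C b * PowerSeries.X * G +
    PowerSeries.C l * PowerSeries.X ^ 2 * G ^ 2)

include hG

theorem constantCoeff_eq_one_of_jfraction : PowerSeries.constantCoeff G = 1 := by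
  rw [hG]
  simp

theorem stieltjesArray_succ_zero (n : ℕ) :
    stieltjesArray G (n + 1) 0 = b * stieltjesArray G n 0 + l * stieltjesArray G n 1 := by
  have h : PowerSeries.X ^ 0 * G ^ (0 + 1) = 1 +
      PowerSeries.X * (PowerSeries.C b * (PowerSeries.X ^ 0 * G ^ (0 + 1))) +
      PowerSeries.X * (PowerSeries.C l * (PowerSeries.X ^ 1 * G ^ (1 + 1))) := by
    linear_combination hG
  rw [stieltjesArray, h, map_add, map_add, PowerSeries.coeff_succ_X_mul,
    PowerSeries.coeff_succ_X_mul, PowerSeries.coeff_C_mul, PowerSeries.coeff_C_mul]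
  simp [stieltjesArray, PowerSeries.coeff_one]

theorem stieltjesArray_succ_succ (n k : ℕ) :
    stieltjesArray G (n + 1) (k + 1) = stieltjesArray G n k +
      b * stieltjesArray G n (k + 1) + l * stieltjesArray G n (k + 2) := by
  have h : PowerSeries.X ^ (k + 1) * G ^ (k + 1 + 1) =
      PowerSeries.X * (PowerSeries.X ^ k * G ^ (k + 1)) +
      PowerSeries.X * (PowerSeries.C b * (PowerSeries.X ^ (k + 1) * G ^ (k + 1 + 1))) +
      PowerSeries.X * (PowerSeries.C l * (PowerSeries.X ^ (k + 2) * G ^ (k + 2 + 1))) := by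
    linear_combination PowerSeries.X ^ (k + 1) * G ^ (k + 1) * hG
  rw [stieltjesArray, h, map_add, map_add, PowerSeries.coeff_succ_X_mul,
    PowerSeries.coeff_succ_X_mul, PowerSeries.coeff_succ_X_mul, PowerSeries.coeff_C_mul,
    PowerSeries.coeff_C_mul]
  rfl

theorem sum_stieltjesArray_succ_mul (m n N : ℕ) (hm : m < N) :
    ∑ k ∈ Finset.range (N + 1), l ^ k * stieltjesArray G (m + 1) k * stieltjesArray G n k =
      b * ∑ k ∈ Finset.range (N + 1), l ^ k * stieltjesArray G m k * stieltjesArray G n k +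
      ∑ k ∈ Finset.range N, l ^ (k + 1) * (stieltjesArray G m k * stieltjesArray G n (k + 1) +
        stieltjesArray G m (k + 1) * stieltjesArray G n k) := by
  have hlast : ∑ k ∈ Finset.range N, l ^ (k + 2) * stieltjesArray G m (k + 2) *
      stieltjesArray G n (k + 1) + l * stieltjesArray G m 1 * stieltjesArray G n 0 =
      ∑ k ∈ Finset.range N, l ^ (k + 1) * stieltjesArray G m (k + 1) * stieltjesArray G n k := by
    have h := Finset.sum_range_succ' (fun k => l ^ (k + 1) * stieltjesArray G m (k + 1) *
      stieltjesArray G n k) N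
    rw [Finset.sum_range_succ, stieltjesArray_of_lt G (show m < N + 1 by omega)] at h
    simpa using h.symm
  rw [Finset.sum_range_succ', Finset.sum_range_succ' _ N]
  simp only [stieltjesArray_succ_zero hG, stieltjesArray_succ_succ hG]
  simp only [mul_add, add_mul, Finset.sum_add_distrib, Finset.mul_sum] at hlast ⊢
  have e₁ : ∀ k, l ^ (k + 1) * (l * stieltjesArray G m (k + 2)) * stieltjesArray G n (k + 1) =
      l ^ (k + 2) * stieltjesArray G m (k + 2) * stieltjesArray G n (k + 1) := fun k => by ring
  have e₂ : ∀ k, l ^ (k + 1) * (b * stieltjesArray G m (k + 1)) * stieltjesArray G n (k + 1) =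
      b * (l ^ (k + 1) * stieltjesArray G m (k + 1) * stieltjesArray G n (k + 1)) :=
    fun k => by ring
  simp only [e₁, e₂]
  simp only [← mul_assoc (l ^ _)]
  linear_combination hlast

theorem sum_stieltjesArray_mul (m n N : ℕ) (h : m + n < N) :
    ∑ k ∈ Finset.range (N + 1), l ^ k * stieltjesArray G m k * stieltjesArray G n k =
      PowerSeries.coeff (m + n) G := by
  induction m generalizing n with
  | zero =>
    rw [Finset.sum_range_succ', Finset.sum_eq_zero]
    · simp [stieltjesArray_zero_right, constantCoeff_eq_one_of_jfraction hG]
    · intro k _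
      simp [stieltjesArray_of_lt G (Nat.succ_pos k)]
  | succ m ih =>
    rw [add_right_comm, add_assoc, ← ih (n + 1) (by omega),
      sum_stieltjesArray_succ_mul hG m n N (by omega)]
    simp only [mul_right_comm (l ^ _) (stieltjesArray G m _) _]
    rw [sum_stieltjesArray_succ_mul hG n m N (by omega)]
    congr 1
    exact Finset.sum_congr rfl fun k _ => by ring

theorem det_hankel_of_jfraction (k : ℕ) :
    Matrix.det (Matrix.of fun i j : Fin k => PowerSeries.coeff (i.1 + j.1) G) =
      l ^ (k * (k - 1) / 2) := by
  set A : Matrix (Fin k) (Fin k) R := Matrix.of fun i j => stieltjesArray G i.1 j.1 with hA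
  have hdet : A.det = 1 := by
    rw [Matrix.det_of_isLowerTriangular]
    · simp [hA, stieltjesArray_self (constantCoeff_eq_one_of_jfraction hG)]
    · intro i j hij
      exact stieltjesArray_of_lt G hij
  have hfac : (Matrix.of fun i j : Fin k => PowerSeries.coeff (i.1 + j.1) G) =
      A * Matrix.diagonal (fun i : Fin k => l ^ i.1) * A.transpose := by
    ext i j
    rw [Matrix.mul_apply, Matrix.of_apply, ← sum_stieltjesArray_mul hG i j (2 * k) (by omega)]
    simp only [Matrix.mul_diagonal, Matrix.transpose_apply, hA, Matrix.of_apply]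
    rw [Fin.sum_univ_eq_sum_range
      (fun x => stieltjesArray G i x * l ^ x * stieltjesArray G j x) k]
    symm
    rw [Finset.sum_subset (Finset.range_subset_range.2 (show k ≤ 2 * k + 1 by omega))]
    · exact Finset.sum_congr rfl fun x _ => by ring
    · intro x _ hx
      rw [Finset.mem_range, not_lt] at hx
      simp [stieltjesArray_of_lt G (i.2.trans_le hx)]
  rw [hfac, Matrix.det_mul, Matrix.det_mul, Matrix.det_transpose, hdet, Matrix.det_diagonal,
    Fin.prod_univ_eq_prod_range (fun x => l ^ x) k, Finset.prod_pow_eq_pow_sum,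
    Finset.sum_range_id, one_mul, mul_one]

end Hankel

/-- The tail of `√(1 - 2tx + x²)` is a multiple of a power series with a constant `J`-fraction. -/
theorem exists_jfraction_of_sq {F : PowerSeries ℝ[X]}
    (hF : (1 - PowerSeries.C (X : ℝ[X]) * PowerSeries.X + PowerSeries.X ^ 2 * F) ^ 2 =
      1 - 2 * PowerSeries.C (X : ℝ[X]) * PowerSeries.X + PowerSeries.X ^ 2) :
    ∃ G : PowerSeries ℝ[X],
      F = PowerSeries.C (C (-1 / 2) * (X ^ 2 - 1) : ℝ[X]) * G ∧
      G = 1 + PowerSeries.C (X : ℝ[X]) * PowerSeries.X * G +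
        PowerSeries.C (C (1 / 4) * (X ^ 2 - 1) : ℝ[X]) * PowerSeries.X ^ 2 * G ^ 2 := by
  set T : PowerSeries ℝ[X] := PowerSeries.C (X : ℝ[X]) with hT
  set h : PowerSeries ℝ[X] := PowerSeries.C (C (1 / 2) : ℝ[X]) with hh
  have h2 : 2 * h = 1 := by
    rw [hh, ← map_ofNat PowerSeries.C 2, ← map_mul, ← map_ofNat C 2, ← map_mul]
    norm_num
  have hc : PowerSeries.C (C (-1 / 2) * (X ^ 2 - 1) : ℝ[X]) = -h * (T ^ 2 - 1) := by
    rw [neg_div]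
    simp [hh, hT]
  have hl : PowerSeries.C (C (1 / 4) * (X ^ 2 - 1) : ℝ[X]) = h ^ 2 * (T ^ 2 - 1) := by
    have : (1 / 4 : ℝ) = (1 / 2) ^ 2 := by norm_num
    rw [this]
    simp only [hh, hT, map_mul, map_pow, map_sub, map_one]
  rw [hc, hl]
  set E := 1 - T * PowerSeries.X + h * PowerSeries.X ^ 2 * F with hE
  set G := PowerSeries.invOfUnit E 1
  have hEG : E * G = 1 := PowerSeries.mul_invOfUnit E 1 (by simp [hE])
  have hFE : F * E = -h * (T ^ 2 - 1) := by
    have hX : (PowerSeries.X ^ 2 : PowerSeries ℝ[X]) ≠ 0 :=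
      pow_ne_zero _ PowerSeries.X_ne_zero
    apply mul_left_cancel₀ hX
    rw [hE]
    linear_combination h * hF - PowerSeries.X ^ 2 * F * (1 - T * PowerSeries.X) * h2
  have hFG : F = -h * (T ^ 2 - 1) * G := by
    linear_combination G * hFE - F * hEG
  refine ⟨G, hFG, ?_⟩
  rw [hE] at hEG
  linear_combination hEG - h * PowerSeries.X ^ 2 * G * hFG

/-- **Hankel determinants of the coefficients of `√(1 − 2tx + x²)`.**
If `(Q_n)` is the sequence of polynomials with `Q₀ = 1` and
`Σ_{i=0}^{n} Q_i·P_{n−i} = 0` for all `n ≥ 1` (so the `Q_n` are the coefficients of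
`√(1 − 2tx + x²)`), then for every `k ≥ 1`,
`det(Q_{i+j+2})_{0≤i,j≤k−1} = (−1)ᵏ·2^{−k²}·(t² − 1)^{k(k+1)/2}` in `ℝ[t]`. -/
theorem hankel_det_legendre_sqrt_coeffs
    (Q : ℕ → Polynomial ℝ) (hQ0 : Q 0 = 1)
    (hQ : ∀ n : ℕ, 1 ≤ n → ∑ i ∈ Finset.range (n + 1), Q i * legendre (n - i) = 0)
    (k : ℕ) (hk : 1 ≤ k) :
    Matrix.det (Matrix.of fun i j : Fin k => Q (i.1 + j.1 + 2)) =
      C ((-1 : ℝ) ^ k * (2 : ℝ) ^ (-((k ^ 2 : ℕ) : ℤ))) *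
        (X ^ 2 - 1) ^ (k * (k + 1) / 2) := by
  have hSy : PowerSeries.mk Q * PowerSeries.mk legendre = 1 := by
    ext1 n
    rw [PowerSeries.coeff_mul, Finset.Nat.sum_antidiagonal_eq_sum_range_succ_mk,
      PowerSeries.coeff_one]
    simp only [PowerSeries.coeff_mk]
    split_ifs with hn
    · simp [hn, hQ0, legendre_zero]
    · exact hQ n (Nat.one_le_iff_ne_zero.2 hn)
  have hQ1 : Q 1 = -X := by
    have := hQ 1 le_rfl
    simp only [Finset.sum_range_succ, Finset.range_zero, Finset.sum_empty, hQ0, Nat.sub_zero,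
      Nat.sub_self, legendre_zero, legendre_one] at this
    linear_combination this
  have hS : PowerSeries.mk Q = 1 - PowerSeries.C (X : ℝ[X]) * PowerSeries.X +
      PowerSeries.X ^ 2 * PowerSeries.mk fun n => Q (n + 2) := by
    ext1 n
    rcases n with _ | _ | n
    · simp [hQ0]
    · simp [hQ1, PowerSeries.coeff_X_pow_mul', PowerSeries.coeff_one]
    · rw [map_add, add_assoc n 1 1, PowerSeries.coeff_X_pow_mul]
      simp [PowerSeries.coeff_one]
  obtain ⟨G, hFG, hG⟩ := exists_jfraction_of_sq (F := PowerSeries.mk fun n => Q (n + 2)) <| by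
    rw [← hS]
    linear_combination (PowerSeries.mk Q) ^ 2 * -legendre_generating_function +
      (1 - 2 * PowerSeries.C (X : ℝ[X]) * PowerSeries.X + PowerSeries.X ^ 2) *
        (PowerSeries.mk Q * PowerSeries.mk legendre + 1) * hSy
  have hmat : (Matrix.of fun i j : Fin k => Q (i.1 + j.1 + 2)) =
      (C (-1 / 2) * (X ^ 2 - 1) : ℝ[X]) •
        Matrix.of fun i j : Fin k => PowerSeries.coeff (i.1 + j.1) G := by
    ext1 i j
    have := congrArg (PowerSeries.coeff (i.1 + j.1)) hFG
    rw [PowerSeries.coeff_mk, PowerSeries.coeff_C_mul] at this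
    simpa using this
  rw [hmat, Matrix.det_smul, det_hankel_of_jfraction hG, Fintype.card_fin, mul_pow, mul_pow,
    mul_mul_mul_comm, ← pow_add, ← C_pow, ← C_pow, ← C_mul]
  obtain ⟨m, rfl⟩ : ∃ m, k = m + 1 := ⟨k - 1, by omega⟩
  obtain ⟨s, hs⟩ := (Nat.even_mul_succ_self m).two_dvd
  have e₁ : (m + 1) * (m + 1 - 1) / 2 = s := by
    rw [Nat.add_sub_cancel, mul_comm, hs]; omega
  have e₂ : (m + 1) * (m + 1 + 1) / 2 = m + 1 + s := by
    rw [show (m + 1) * (m + 1 + 1) = 2 * (m + 1 + s) by linarith]; omega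
  have e₃ : (m + 1) ^ 2 = m + 1 + 2 * s := by linarith
  rw [e₁, e₂, e₃]
  congr 2
  have h4 : (1 / 4 : ℝ) = (1 / 2) ^ 2 := by norm_num
  rw [h4, zpow_neg, zpow_natCast, div_pow, ← pow_mul, one_div, inv_pow, pow_add 2 (m + 1), mul_inv,
    div_eq_mul_inv, mul_assoc]
end

section
/- Let k be a field, S = k[x₀,…,x_n] the polynomial ring in n+1 variables, f ∈ S a homogeneous polynomial of degree d > 0, q ≥ 1 an integer, and I = (x₀^q,…,x_n^q). Then for every integer j, the k-dimension of the degree-j homogeneous component of S/(I + (f)) equals the k-dimension of the degree-((n+1)(q−1) − j) homogeneous component of the graded module (I : f)/I. -/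
open MvPolynomial

/-- The dimension of the degree-`j` homogeneous component of `S/J`, where
`S = k[x₀,…,x_{N−1}]`: the `k`-dimension of the image in `S/J` of the space of
homogeneous polynomials of degree `j` (zero for negative `j`). -/
noncomputable def quotComponentDim (k : Type*) [Field k] (N : ℕ)
    (J : Ideal (MvPolynomial (Fin N) k)) (j : ℤ) : ℕ :=
  if 0 ≤ j then
    Module.finrank k ((homogeneousSubmodule (Fin N) k j.toNat).map
      (Ideal.Quotient.mkₐ k J).toLinearMap)
  else 0

/-- The dimension of the degree-`j` homogeneous component of `(I : f)/I`: the
`k`-dimension of the image in `S/I` of the space of homogeneous polynomials of degree `j`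
lying in the ideal quotient `(I : f)` (zero for negative `j`). -/
noncomputable def colonComponentDim (k : Type*) [Field k] (N : ℕ)
    (I : Ideal (MvPolynomial (Fin N) k)) (f : MvPolynomial (Fin N) k) (j : ℤ) : ℕ :=
  if 0 ≤ j then
    Module.finrank k ((homogeneousSubmodule (Fin N) k j.toNat ⊓
        Submodule.restrictScalars k (Submodule.colon I (Ideal.span {f}))).map
      (Ideal.Quotient.mkₐ k I).toLinearMap)
  else 0

namespace MvPolynomial

variable {k : Type*} [Field k]

/-- The exponent all of whose entries are `q - 1`: the exponent of the socle monomial modulo the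
`q`-th powers of the variables. -/
noncomputable def socleExponent (N q : ℕ) : Fin N →₀ ℕ :=
  Finsupp.equivFunOnFinite.symm fun _ => q - 1

theorem degree_socleExponent (N q : ℕ) : (socleExponent N q).degree = N * (q - 1) := by
  simp [socleExponent, Finsupp.degree_eq_sum]

theorem mem_span_range_X_pow_iff {N q : ℕ} (hq : 1 ≤ q) (g : MvPolynomial (Fin N) k) :
    g ∈ Ideal.span (Set.range fun i : Fin N => (X i : MvPolynomial (Fin N) k) ^ q) ↔
      ∀ m ≤ socleExponent N q, coeff m g = 0 := by
  have hset : (Set.range fun i : Fin N => (X i : MvPolynomial (Fin N) k) ^ q) =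
      (fun s => monomial s (1 : k)) '' Set.range fun i : Fin N => Finsupp.single i q := by
    ext p
    simp [X_pow_eq_monomial]
  rw [hset, mem_ideal_span_monomial_image]
  refine forall_congr' fun m => ?_
  have hle : (∃ s ∈ Set.range fun i : Fin N => Finsupp.single i q, s ≤ m) ↔
      ¬ m ≤ socleExponent N q := by
    rw [Set.exists_range_iff, Finsupp.le_def, not_forall]
    refine exists_congr fun i => ?_
    simp only [Finsupp.single_le_iff, socleExponent, Finsupp.equivFunOnFinite_symm_apply_apply]
    omega
  rw [hle, mem_support_iff]
  tauto

theorem coeff_eq_coeff_mul_monomial_tsub {σ : Type*} {u m : σ →₀ ℕ} (hm : m ≤ u)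
    (g : MvPolynomial σ k) : coeff m g = coeff u (g * monomial (u - m) 1) := by
  have h := coeff_mul_monomial m (u - m) (1 : k) g
  rw [add_tsub_cancel_of_le hm, mul_one] at h
  exact h.symm

theorem coeff_mul_eq_zero_of_mem_span_range_X_pow {N q : ℕ} (hq : 1 ≤ q)
    {g : MvPolynomial (Fin N) k}
    (hg : g ∈ Ideal.span (Set.range fun i : Fin N => (X i : MvPolynomial (Fin N) k) ^ q))
    (h : MvPolynomial (Fin N) k) : coeff (socleExponent N q) (g * h) = 0 :=
  (mem_span_range_X_pow_iff hq _).1 (Ideal.mul_mem_right h _ hg) _ le_rfl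

theorem IsHomogeneous.mem_span_range_X_pow {N q b : ℕ} (hq : 1 ≤ q)
    {g : MvPolynomial (Fin N) k} (hg : g.IsHomogeneous b)
    (h : ∀ m ≤ socleExponent N q, m.degree = b → coeff m g = 0) :
    g ∈ Ideal.span (Set.range fun i : Fin N => (X i : MvPolynomial (Fin N) k) ^ q) := by
  refine (mem_span_range_X_pow_iff hq _).2 fun m hm => ?_
  by_cases hb : m.degree = b
  · exact h m hm hb
  · exact hg.coeff_eq_zero hb

theorem IsHomogeneous.mem_span_range_X_pow_of_lt {N q b : ℕ} (hq : 1 ≤ q)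
    {g : MvPolynomial (Fin N) k} (hg : g.IsHomogeneous b) (hb : N * (q - 1) < b) :
    g ∈ Ideal.span (Set.range fun i : Fin N => (X i : MvPolynomial (Fin N) k) ^ q) := by
  refine hg.mem_span_range_X_pow hq fun m hm hmb => ?_
  have := Finsupp.degree_mono hm
  rw [degree_socleExponent] at this
  omega

/-- The bilinear form sending `(h, g)` to the coefficient of `g * h` at the exponent `u`. -/
noncomputable def coeffMulForm {σ : Type*} (u : σ →₀ ℕ) :
    MvPolynomial σ k →ₗ[k] MvPolynomial σ k →ₗ[k] k :=
  (LinearMap.mul k (MvPolynomial σ k)).flip.compr₂ (lcoeff k u)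

theorem coeffMulForm_apply {σ : Type*} (u : σ →₀ ℕ) (h g : MvPolynomial σ k) :
    coeffMulForm u h g = coeff u (g * h) := rfl

/-- Every functional on forms of degree `a` that kills those in `(x₁^q, …, x_N^q)` is represented
by a form of complementary degree. -/
theorem exists_isHomogeneous_coeff_mul_eq {N q a b : ℕ} (hq : 1 ≤ q) (hab : a + b = N * (q - 1))
    (φ : MvPolynomial (Fin N) k →ₗ[k] k)
    (hφ : ∀ g : MvPolynomial (Fin N) k, g.IsHomogeneous a →
      g ∈ Ideal.span (Set.range fun i : Fin N => (X i : MvPolynomial (Fin N) k) ^ q) → φ g = 0) :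
    ∃ h : MvPolynomial (Fin N) k, h.IsHomogeneous b ∧
      ∀ g : MvPolynomial (Fin N) k, g.IsHomogeneous a →
        coeff (socleExponent N q) (g * h) = φ g := by
  classical
  set u := socleExponent N q with hu
  set T := (Finset.Iic u).filter fun m => m.degree = a with hT
  have hmem (m) : m ∈ T ↔ m ≤ u ∧ m.degree = a := by simp [hT]
  refine ⟨∑ m ∈ T, φ (monomial m 1) • monomial (u - m) 1, ?_, fun g hg => ?_⟩
  · refine IsHomogeneous.sum _ _ _ fun m hm => ?_
    rw [smul_monomial]
    refine isHomogeneous_monomial _ ?_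
    obtain ⟨hmu, hma⟩ := (hmem m).1 hm
    have h := congrArg Finsupp.degree (add_tsub_cancel_of_le hmu)
    rw [map_add, hma, hu, degree_socleExponent, ← hab] at h
    exact Nat.add_left_cancel h
  · have hsum : (∑ m ∈ T, coeff m g • monomial m (1 : k)).IsHomogeneous a := by
      refine IsHomogeneous.sum _ _ _ fun m hm => ?_
      rw [smul_monomial]
      exact isHomogeneous_monomial _ ((hmem m).1 hm).2
    have hrest := hφ _ (hg.sub hsum) <|
      (hg.sub hsum).mem_span_range_X_pow hq fun m hm hma => by
        simp [coeff_sum, coeff_monomial, (hmem m).2 ⟨hm, hma⟩]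
    rw [map_sub, sub_eq_zero] at hrest
    rw [hrest, map_sum, Finset.mul_sum, coeff_sum]
    refine Finset.sum_congr rfl fun m hm => ?_
    rw [mul_smul_comm, coeff_smul, ← coeff_eq_coeff_mul_monomial_tsub ((hmem m).1 hm).1, map_smul,
      smul_eq_mul, smul_eq_mul, mul_comm]

/-- If `h` is orthogonal to the forms of complementary degree in `(f)`, then `h * f` lies in
`(x₁^q, …, x_N^q)`. -/
theorem IsHomogeneous.mul_mem_span_range_X_pow {N q a b d : ℕ} (hq : 1 ≤ q)
    (hab : a + b = N * (q - 1)) {f h : MvPolynomial (Fin N) k} (hf : f.IsHomogeneous d)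
    (hh : h.IsHomogeneous b)
    (horth : ∀ g ∈ Ideal.span {f}, g.IsHomogeneous a → coeff (socleExponent N q) (g * h) = 0) :
    h * f ∈ Ideal.span (Set.range fun i : Fin N => (X i : MvPolynomial (Fin N) k) ^ q) := by
  refine (hh.mul hf).mem_span_range_X_pow hq fun m hm hmd => ?_
  have hdeg := congrArg Finsupp.degree (add_tsub_cancel_of_le hm)
  rw [map_add, degree_socleExponent] at hdeg
  rw [coeff_eq_coeff_mul_monomial_tsub hm, mul_assoc, mul_comm]
  refine horth _ (Ideal.mul_mem_right _ _ (Ideal.mem_span_singleton_self f)) ?_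
  have := hf.mul (isHomogeneous_monomial (1 : k) (rfl : (socleExponent N q - m).degree = _))
  rwa [show d + (socleExponent N q - m).degree = a by omega] at this

end MvPolynomial

/-- If the functionals `L w`, `w ∈ W`, restrict to exactly the functionals on `V` killing
`V ⊓ ker π`, and `L w` vanishes on `V` iff `ρ w = 0`, then `π V` and `ρ W` have the same
dimension. -/
theorem finrank_map_eq_finrank_map_of_pairing {k E F A B : Type*} [Field k]
    [AddCommGroup E] [Module k E] [AddCommGroup F] [Module k F]
    [AddCommGroup A] [Module k A] [AddCommGroup B] [Module k B]
    (L : F →ₗ[k] E →ₗ[k] k) (V : Submodule k E) (W : Submodule k F)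
    (π : E →ₗ[k] A) (ρ : F →ₗ[k] B)
    (hker : ∀ w ∈ W, ρ w = 0 ↔ ∀ v ∈ V, L w v = 0)
    (horth : ∀ w ∈ W, ∀ v ∈ V, π v = 0 → L w v = 0)
    (hsurj : ∀ φ : E →ₗ[k] k, (∀ v ∈ V, π v = 0 → φ v = 0) → ∃ w ∈ W, ∀ v ∈ V, L w v = φ v) :
    Module.finrank k (V.map π) = Module.finrank k (W.map ρ) := by
  let M : W →ₗ[k] Module.Dual k V := L.domRestrict₁₂ W V
  have hM : LinearMap.ker M = LinearMap.ker (ρ.domRestrict W) := by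
    ext ⟨w, hw⟩
    rw [LinearMap.mem_ker, LinearMap.mem_ker, LinearMap.domRestrict_apply, hker w hw,
      LinearMap.ext_iff, Subtype.forall]
    rfl
  have hrange : LinearMap.range M =
      (LinearMap.ker (π.domRestrict V)).dualAnnihilator := by
    ext φ
    rw [LinearMap.mem_range, Submodule.mem_dualAnnihilator]
    constructor
    · rintro ⟨⟨w, hw⟩, rfl⟩ ⟨v, hv⟩ hπ
      exact horth w hw v hv hπ
    · intro hφ
      obtain ⟨ψ, hψ⟩ := LinearMap.exists_extend φ
      have hψ' (v : V) : ψ v = φ v := LinearMap.congr_fun hψ v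
      obtain ⟨w, hw, h⟩ := hsurj ψ fun v hv hπ => (hψ' ⟨v, hv⟩).trans (hφ ⟨v, hv⟩ hπ)
      exact ⟨⟨w, hw⟩, LinearMap.ext fun v => (h v v.2).trans (hψ' v)⟩
  rw [← LinearMap.range_domRestrict, ← LinearMap.range_domRestrict,
    ← (π.domRestrict V).quotKerEquivRange.finrank_eq,
    ← (ρ.domRestrict W).quotKerEquivRange.finrank_eq,
    ← (Submodule.quotEquivOfEq _ _ hM).finrank_eq, M.quotKerEquivRange.finrank_eq, hrange,
    ← (LinearMap.ker (π.domRestrict V)).dualQuotEquivDualAnnihilator.finrank_eq,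
    Subspace.dual_finrank_eq]

/-- **Duality between `S/(I+(f))` and `(I:f)/I`.**  For `S = k[x₀,…,x_n]`, `f` homogeneous
of degree `d > 0`, `q ≥ 1` and `I = (x₀^q,…,x_n^q)`, the degree-`j` component of
`S/(I+(f))` and the degree-`((n+1)(q−1) − j)` component of `(I:f)/I` have the same
`k`-dimension, for every integer `j`. -/
theorem quot_component_dim_eq_colon_component_dim
    (k : Type*) [Field k] (n : ℕ) (d : ℕ) (hd : 0 < d)
    (f : MvPolynomial (Fin (n + 1)) k) (hf : f.IsHomogeneous d)
    (q : ℕ) (hq : 1 ≤ q)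
    (I : Ideal (MvPolynomial (Fin (n + 1)) k))
    (hI : I = Ideal.span (Set.range fun i : Fin (n + 1) => X i ^ q))
    (j : ℤ) :
    quotComponentDim k (n + 1) (I + Ideal.span {f}) j =
      colonComponentDim k (n + 1) I f (((n + 1) * (q - 1) : ℕ) - j) := by
  subst hI
  set s := (n + 1) * (q - 1) with hs
  set I := Ideal.span (Set.range fun i : Fin (n + 1) => (X i : MvPolynomial (Fin (n + 1)) k) ^ q)
  have hzero (b : ℕ) (hb : s < b) (J : Ideal (MvPolynomial (Fin (n + 1)) k)) (hJ : I ≤ J)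
      (V : Submodule k (MvPolynomial (Fin (n + 1)) k)) (hV : V ≤ homogeneousSubmodule _ k b) :
      Module.finrank k (V.map (Ideal.Quotient.mkₐ k J).toLinearMap) = 0 := by
    rw [LinearMap.le_ker_iff_map.1, finrank_bot]
    exact fun g hg => Ideal.Quotient.eq_zero_iff_mem.2 (hJ (IsHomogeneous.mem_span_range_X_pow_of_lt
      hq ((mem_homogeneousSubmodule _ _).1 (hV hg)) hb))
  unfold quotComponentDim colonComponentDim
  rcases lt_or_ge j 0 with hj | hj
  · rw [if_neg (by omega), if_pos (by omega),
      hzero (s - j : ℤ).toNat (by omega) _ le_rfl _ inf_le_left]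
  rcases lt_or_ge (s : ℤ) j with hj' | hj'
  · rw [if_pos hj, if_neg (by omega)]
    exact hzero j.toNat (by omega) _ le_sup_left _ le_rfl
  rw [if_pos hj, if_pos (by omega)]
  have hab : j.toNat + ((s : ℤ) - j).toNat = (n + 1) * (q - 1) := by omega
  generalize j.toNat = a at hab
  generalize ((s : ℤ) - j).toNat = b at hab
  have hcolon (h : MvPolynomial (Fin (n + 1)) k) :
      h ∈ Submodule.colon I (Ideal.span {f} : Set (MvPolynomial (Fin (n + 1)) k)) ↔ h * f ∈ I :=
    Ideal.mem_colon_span_singleton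
  refine finrank_map_eq_finrank_map_of_pairing (coeffMulForm (socleExponent (n + 1) q)) _ _ _ _
    ?_ ?_ ?_
  · rintro h ⟨hh, -⟩
    refine Ideal.Quotient.eq_zero_iff_mem.trans ⟨fun hI g _ => ?_, fun horth => ?_⟩
    · rw [coeffMulForm_apply, mul_comm]
      exact coeff_mul_eq_zero_of_mem_span_range_X_pow hq hI g
    · have := IsHomogeneous.mul_mem_span_range_X_pow hq hab (isHomogeneous_one _ k) hh
        fun g _ hg => horth g hg
      rwa [mul_one] at this
  · rintro h ⟨-, hh⟩ g - hg
    obtain ⟨y, hy, z, hz, rfl⟩ := Submodule.mem_sup.1 (Ideal.Quotient.eq_zero_iff_mem.1 hg)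
    obtain ⟨c, rfl⟩ := Ideal.mem_span_singleton.1 hz
    rw [coeffMulForm_apply, add_mul, coeff_add,
      coeff_mul_eq_zero_of_mem_span_range_X_pow hq hy, zero_add,
      show f * c * h = h * f * c by ring]
    exact coeff_mul_eq_zero_of_mem_span_range_X_pow hq ((hcolon h).1 hh) c
  · intro φ hφ
    obtain ⟨h, hh, hrep⟩ := exists_isHomogeneous_coeff_mul_eq hq hab φ fun g hg hgI =>
      hφ g hg (Ideal.Quotient.eq_zero_iff_mem.2 (le_sup_left (a := I) hgI))
    refine ⟨h, ⟨hh, (hcolon h).2 ?_⟩, hrep⟩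
    exact hf.mul_mem_span_range_X_pow hq hab hh fun g hgf hg => (hrep g hg).trans
      (hφ g hg (Ideal.Quotient.eq_zero_iff_mem.2 (le_sup_right (a := I) hgf)))
end

section
/- Let k be a field, S = k[x₀,…,x_n] the polynomial ring in n+1 variables with n ≥ 1, q ≥ 1 an integer, and f ∈ S a homogeneous polynomial of degree d with 0 < d ≤ (n+1)(q−1). Set I = (x₀^q,…,x_n^q) and m(q) = ⌊((n+1)(q−1) + d − 1)/2⌋. Then the socle degree of S/(I + (f)) is at least m(q); that is, there exists a homogeneous polynomial of degree m(q) that does not lie in the ideal I + (f). -/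
open MvPolynomial

/-- The number of vectors in `{0, …, q - 1}^r` whose coordinates sum to `j`. -/
def boxCount (q r : ℕ) (j : ℤ) : ℕ :=
  Fintype.card {v : Fin r → Fin q // ∑ i, ((v i : ℕ) : ℤ) = j}

theorem boxCount_eq_zero_of_neg (q r : ℕ) {j : ℤ} (hj : j < 0) : boxCount q r j = 0 := by
  rw [boxCount, Fintype.card_eq_zero_iff]
  refine ⟨fun v => ?_⟩
  have h : 0 ≤ ∑ i, ((v.1 i : ℕ) : ℤ) := Finset.sum_nonneg fun i _ => by positivity
  have := v.2
  omega

theorem boxCount_zero (q : ℕ) (j : ℤ) : boxCount q 0 j = if j = 0 then 1 else 0 := by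
  unfold boxCount
  split_ifs with h
  · subst h
    rw [Fintype.card_eq_one_iff]
    exact ⟨⟨Fin.elim0, by simp⟩, fun v => Subsingleton.elim _ _⟩
  · rw [Fintype.card_eq_zero_iff]
    exact ⟨fun v => h (by simpa using v.2.symm)⟩

theorem boxCount_succ (q r : ℕ) (j : ℤ) :
    boxCount q (r + 1) j = ∑ t ∈ Finset.range q, boxCount q r (j - t) := by
  rw [Finset.sum_range]
  unfold boxCount
  rw [← Fintype.card_sigma]
  refine Fintype.card_congr
    { toFun := fun v => ⟨v.1 0, fun i => v.1 i.succ, ?_⟩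
      invFun := fun s => ⟨Fin.cons s.1 s.2.1, ?_⟩
      left_inv := fun v => ?_
      right_inv := fun s => ?_ }
  · have := v.2
    rw [Fin.sum_univ_succ] at this
    dsimp only
    omega
  · have := s.2.2
    rw [Fin.sum_univ_succ]
    simp only [Fin.cons_zero, Fin.cons_succ]
    omega
  · exact Subtype.ext (Fin.cons_self_tail v.1)
  · rfl

theorem boxCount_reflect (q r : ℕ) (j : ℤ) :
    boxCount q r (r * (q - 1) - j) = boxCount q r j := by
  unfold boxCount
  refine Fintype.card_congr
    ((Equiv.piCongrRight fun _ : Fin r => Fin.revPerm (n := q)).subtypeEquiv fun v => ?_)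
  have h : ∀ i, ((((v i).rev : Fin q) : ℕ) : ℤ) = (q - 1) - ((v i : ℕ) : ℤ) := fun i => by
    rw [Fin.val_rev]
    have := (v i).2
    omega
  simp only [Equiv.piCongrRight_apply, Pi.map_apply, Fin.revPerm_apply, h,
    Finset.sum_sub_distrib, Finset.sum_const, Finset.card_univ, Fintype.card_fin, nsmul_eq_mul]
  constructor <;> intro h <;> linarith

theorem boxCount_succ_add (q r : ℕ) (j : ℤ) :
    boxCount q (r + 1) j + boxCount q r (j - q) =
      boxCount q (r + 1) (j - 1) + boxCount q r j := by
  have h := Finset.sum_range_succ (fun t : ℕ => boxCount q r (j - t)) q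
  rw [Finset.sum_range_succ'] at h
  rw [boxCount_succ, boxCount_succ, ← h]
  simp only [Nat.cast_add, Nat.cast_one, Nat.cast_zero, sub_zero, add_comm _ (1 : ℤ), sub_sub]

theorem boxCount_lt_of_step {q r : ℕ}
    (hstep : ∀ b : ℤ, 0 ≤ b → 2 * b ≤ r * (q - 1) → boxCount q r (b - 1) < boxCount q r b)
    {a b : ℤ} (hab : a < b) (hsum : a + b < r * (q - 1)) (hb : 0 ≤ b)
    (hb' : b ≤ r * (q - 1)) : boxCount q r a < boxCount q r b := by
  have low : ∀ c : ℕ, 2 * (c : ℤ) ≤ r * (q - 1) → ∀ a : ℤ, a < c →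
      boxCount q r a < boxCount q r c := by
    intro c
    induction c with
    | zero =>
      intro hc a ha
      rw [boxCount_eq_zero_of_neg q r (by simpa using ha)]
      exact (Nat.zero_le _).trans_lt (hstep _ le_rfl hc)
    | succ c ih =>
      intro hc a ha
      have h := hstep (c + 1 : ℕ) (by positivity) hc
      rw [show (((c + 1 : ℕ) : ℤ) - 1) = c by push_cast; ring] at h
      rcases (show a < c ∨ a = c by push_cast at ha; omega) with h1 | rfl
      · exact (ih (by push_cast at hc; linarith) a h1).trans h
      · exact h
  by_cases h : 2 * b ≤ r * (q - 1)
  · lift b to ℕ using hb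
    exact low b h a hab
  · rw [← boxCount_reflect q r b]
    obtain ⟨c, hc⟩ := Int.eq_ofNat_of_zero_le (sub_nonneg.2 hb')
    rw [hc]
    exact low c (by linarith) a (by linarith)

theorem boxCount_lt {q : ℕ} (hq : 1 ≤ q) (n : ℕ) {a b : ℤ} (hab : a < b)
    (hsum : a + b < (n + 2 : ℕ) * (q - 1)) (hb : 0 ≤ b) (hb' : b ≤ (n + 2 : ℕ) * (q - 1)) :
    boxCount q (n + 2) a < boxCount q (n + 2) b := by
  have hq' : (1 : ℤ) ≤ q := by exact_mod_cast hq
  induction n generalizing a b with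
  | zero =>
    refine boxCount_lt_of_step (fun b hb hb' => ?_) hab hsum hb hb'
    have h := boxCount_succ_add q 1 b
    have h_neg : boxCount q 1 (b - q) = 0 :=
      boxCount_eq_zero_of_neg _ _ (by push_cast at hb'; linarith)
    have h_pos : 0 < boxCount q 1 b := by
      rw [boxCount_succ]
      refine Finset.sum_pos' (fun _ _ => Nat.zero_le _) ⟨b.toNat, ?_, ?_⟩
      · rw [Finset.mem_range]
        push_cast at hb'
        omega
      · rw [boxCount_zero, if_pos (by omega)]
        exact one_pos
    norm_num at h ⊢
    omega
  | succ n ih =>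
    refine boxCount_lt_of_step (fun b hb hb' => ?_) hab hsum hb hb'
    have h := boxCount_succ_add q (n + 2) b
    have hn : (0 : ℤ) ≤ n * (q - 1) := mul_nonneg (by positivity) (by linarith)
    push_cast at hb'
    have hlt := ih (a := b - q) (b := b) (by linarith) (by push_cast; linarith) hb
      (by push_cast; linarith)
    rw [show n + 1 + 2 = n + 2 + 1 by ring]
    omega

/-- The exponent vector of a monomial all of whose exponents are less than `q`. -/
noncomputable def boxExponent {q r : ℕ} (v : Fin r → Fin q) : Fin r →₀ ℕ :=
  Finsupp.equivFunOnFinite.symm fun i => (v i : ℕ)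

theorem boxExponent_injective {q r : ℕ} :
    Function.Injective (boxExponent : (Fin r → Fin q) → (Fin r →₀ ℕ)) := fun _ _ h =>
  funext fun i => Fin.ext (DFunLike.congr_fun h i)

theorem degree_boxExponent {q r : ℕ} (v : Fin r → Fin q) :
    (boxExponent v).degree = ∑ i, (v i : ℕ) := by
  rw [Finsupp.degree_eq_sum]
  rfl

theorem coeff_boxExponent_eq_zero {k : Type*} [CommSemiring k] {q r : ℕ}
    {p : MvPolynomial (Fin r) k}
    (hp : p ∈ Ideal.span (Set.range fun i : Fin r => (X i : MvPolynomial (Fin r) k) ^ q))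
    (v : Fin r → Fin q) : coeff (boxExponent v) p = 0 := by
  have hrange : (Set.range fun i : Fin r => (X i : MvPolynomial (Fin r) k) ^ q) =
      (fun s => monomial s 1) '' Set.range fun i : Fin r => Finsupp.single i q := by
    rw [← Set.range_comp]
    exact congrArg Set.range (funext fun i => X_pow_eq_monomial)
  rw [hrange, mem_ideal_span_monomial_image] at hp
  by_contra h
  obtain ⟨_, ⟨i, rfl⟩, hi⟩ := hp _ (mem_support_iff.2 h)
  have hqi := hi i
  rw [Finsupp.single_eq_same] at hqi
  exact (v i).2.not_ge hqi

/-- The coefficients of a polynomial at the monomials of degree `m` with all exponents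
less than `q`. -/
noncomputable def boxCoeff (k : Type*) [CommSemiring k] (q r : ℕ) (m : ℤ) :
    MvPolynomial (Fin r) k →ₗ[k]
      ({v : Fin r → Fin q // ∑ i, ((v i : ℕ) : ℤ) = m} → k) :=
  LinearMap.pi fun v => lcoeff k (boxExponent v.1)

theorem boxCoeff_mul_mem_span {k : Type*} [CommSemiring k] {q r d : ℕ} (m : ℤ)
    {f : MvPolynomial (Fin r) k} (hf : f.IsHomogeneous d) (g : MvPolynomial (Fin r) k) :
    boxCoeff k q r m (g * f) ∈ Submodule.span k (Set.range
      fun v : {v : Fin r → Fin q // ∑ i, ((v i : ℕ) : ℤ) = m - d} =>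
        boxCoeff k q r m (monomial (boxExponent v.1) 1 * f)) := by
  induction g using MvPolynomial.induction_on' with
  | add g₁ g₂ h₁ h₂ =>
    rw [add_mul, map_add]
    exact Submodule.add_mem _ h₁ h₂
  | monomial w c =>
    rw [show monomial w c = c • monomial w 1 by rw [smul_monomial, smul_eq_mul, mul_one],
      smul_mul_assoc, map_smul]
    refine Submodule.smul_mem _ _ ?_
    by_cases hw : ∃ v : {v : Fin r → Fin q // ∑ i, ((v i : ℕ) : ℤ) = m - d},
        boxExponent v.1 = w
    · obtain ⟨v, rfl⟩ := hw
      exact Submodule.subset_span ⟨v, rfl⟩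
    · convert Submodule.zero_mem _
      ext u
      change coeff (boxExponent u.1) (monomial w 1 * f) = 0
      rw [coeff_monomial_mul', one_mul]
      split_ifs with hle
      · by_contra hne
        have hlt : ∀ i, w i < q := fun i => (hle i).trans_lt (u.1 i).2
        have hwv : boxExponent (fun i => (⟨w i, hlt i⟩ : Fin q)) = w := by
          ext i
          rfl
        refine hw ⟨⟨fun i => ⟨w i, hlt i⟩, ?_⟩, hwv⟩
        have hdeg : (boxExponent u.1 - w).degree = d := by
          rw [Finsupp.degree_eq_weight_one]
          exact hf hne
        have hadd := congrArg Finsupp.degree (tsub_add_cancel_of_le hle)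
        rw [map_add, hdeg, degree_boxExponent, Finsupp.degree_eq_sum] at hadd
        have hu := u.2
        zify at hadd
        linarith
      · rfl

theorem boxCount_le_of_homogeneous_mem {k : Type*} [Field k] {q r d m : ℕ}
    {f : MvPolynomial (Fin r) k} (hf : f.IsHomogeneous d)
    (h : ∀ g : MvPolynomial (Fin r) k, g.IsHomogeneous m →
      g ∈ Ideal.span (Set.range fun i : Fin r => (X i : MvPolynomial (Fin r) k) ^ q) +
        Ideal.span {f}) :
    boxCount q r m ≤ boxCount q r (m - d) := by
  classical
  let W := Submodule.span k (Set.range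
      fun v : {v : Fin r → Fin q // ∑ i, ((v i : ℕ) : ℤ) = m - d} =>
        boxCoeff k q r m (monomial (boxExponent v.1) 1 * f))
  have hW : W = ⊤ := by
    rw [eq_top_iff, ← (Pi.basisFun k _).span_eq, Submodule.span_le]
    rintro _ ⟨u, rfl⟩
    have hu : (monomial (boxExponent u.1) (1 : k)).IsHomogeneous m := by
      refine isHomogeneous_monomial _ ?_
      rw [degree_boxExponent]
      exact_mod_cast u.2
    obtain ⟨p, hp, s, hs, hps⟩ := Submodule.mem_sup.1 (h _ hu)
    obtain ⟨g, rfl⟩ := Ideal.mem_span_singleton'.1 hs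
    have hp0 : boxCoeff k q r m p = 0 := funext fun v => coeff_boxExponent_eq_zero hp v.1
    have hbasis : boxCoeff k q r m (monomial (boxExponent u.1) 1) = Pi.basisFun k _ u := by
      ext v
      change coeff (boxExponent v.1) (monomial (boxExponent u.1) (1 : k)) = _
      rw [coeff_monomial, Pi.basisFun_apply, Pi.single_apply]
      simp only [boxExponent_injective.eq_iff, Subtype.ext_iff, eq_comm]
    rw [← hbasis, ← hps, map_add, hp0, zero_add]
    exact boxCoeff_mul_mem_span m hf g
  calc boxCount q r m
      = Module.finrank k ({v : Fin r → Fin q // ∑ i, ((v i : ℕ) : ℤ) = m} → k) :=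
        (Module.finrank_fintype_fun_eq_card k).symm
    _ = Module.finrank k W := by rw [hW, finrank_top]
    _ ≤ boxCount q r (m - d) := finrank_range_le_card _

/-- **Lower bound for the socle degree.**  For `S = k[x₀,…,x_n]` with `n ≥ 1`, `q ≥ 1`,
`f` homogeneous of degree `d` with `0 < d ≤ (n+1)(q−1)`, and `I = (x₀^q,…,x_n^q)`,
there is a homogeneous polynomial of degree `m(q) = ⌊((n+1)(q−1)+d−1)/2⌋` not lying
in `I + (f)`; hence the socle degree of `S/(I+(f))` is at least `m(q)`. -/
theorem socle_degree_lower_bound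
    (k : Type*) [Field k] (n : ℕ) (hn : 1 ≤ n) (q : ℕ) (hq : 1 ≤ q) (d : ℕ)
    (hd : 0 < d) (hd' : d ≤ (n + 1) * (q - 1))
    (f : MvPolynomial (Fin (n + 1)) k) (hf : f.IsHomogeneous d)
    (I : Ideal (MvPolynomial (Fin (n + 1)) k))
    (hI : I = Ideal.span (Set.range fun i : Fin (n + 1) => X i ^ q)) :
    ∃ g : MvPolynomial (Fin (n + 1)) k,
      g.IsHomogeneous (((n + 1) * (q - 1) + d - 1) / 2) ∧
      g ∉ I + Ideal.span {f} := by
  by_contra! hcon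
  subst hI
  obtain ⟨n, rfl⟩ := Nat.exists_eq_add_of_le' hn
  have hle := boxCount_le_of_homogeneous_mem hf hcon
  have hN : (((n + 2 : ℕ) : ℤ) * (q - 1)) = ((n + 1 + 1) * (q - 1) : ℕ) := by
    push_cast [Nat.cast_sub hq]
    ring
  refine hle.not_gt (boxCount_lt hq n ?_ ?_ ?_ ?_) <;>
  · try rw [hN]
    omega
end

section
/- Let k be a field, a₁, a₂ ∈ k, and Q = t² + a₁st − a₂s² ∈ k[s,t]. Let q ≥ 1 be an integer. If u, v, w ∈ k[s,t] satisfy u·s^q·Q^q + v·t^q·Q^q + w·s^{3q} = 0, then there exist p₁, p₂ ∈ k[s,t] such that (u, v, w) = p₁·(t^q, −s^q, 0) + p₂·(s^{2q}, 0, −Q^q); that is, the syzygy module of the three polynomials s^qQ^q, t^qQ^q, s^{3q} is generated by (t^q, −s^q, 0) and (s^{2q}, 0, −Q^q). -/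
open MvPolynomial

/-- **The syzygies of `s^qQ^q, t^qQ^q, s^{3q}`.**
Let `Q = t² + a₁st − a₂s² ∈ k[s,t]` and `q ≥ 1`.  Every syzygy `(u,v,w)` of the three
polynomials `s^qQ^q`, `t^qQ^q`, `s^{3q}` is a `k[s,t]`-combination of the two syzygies
`(t^q, −s^q, 0)` and `(s^{2q}, 0, −Q^q)`. -/
theorem syzygy_module_of_parametrized_cubic
    (k : Type*) [Field k] (a₁ a₂ : k) (Q : MvPolynomial (Fin 2) k)
    (hQ : Q = (X 1) ^ 2 + C a₁ * X 0 * X 1 - C a₂ * (X 0) ^ 2)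
    (q : ℕ) (hq : 1 ≤ q)
    (u v w : MvPolynomial (Fin 2) k)
    (hsyz : u * (X 0 ^ q * Q ^ q) + v * (X 1 ^ q * Q ^ q) + w * X 0 ^ (3 * q) = 0) :
    ∃ p₁ p₂ : MvPolynomial (Fin 2) k,
      u = p₁ * X 1 ^ q + p₂ * X 0 ^ (2 * q) ∧
      v = -(p₁ * X 0 ^ q) ∧
      w = -(p₂ * Q ^ q) := by
  have hs : Prime (X 0 : MvPolynomial (Fin 2) k) := X_prime
  have ht : ¬ (X 0 : MvPolynomial (Fin 2) k) ∣ X 1 := by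
    simp [X_dvd_X]
  have hsQ : ¬ (X 0 : MvPolynomial (Fin 2) k) ∣ Q := by
    rintro ⟨r, hr⟩
    refine ht (hs.dvd_of_dvd_pow (n := 2) ⟨r - C a₁ * X 1 + C a₂ * X 0, ?_⟩)
    linear_combination hr - hQ
  have htQ : ¬ (X 0 : MvPolynomial (Fin 2) k) ∣ X 1 ^ q * Q ^ q := fun h =>
    (hs.dvd_or_dvd h).elim (fun h => ht (hs.dvd_of_dvd_pow h))
      (fun h => hsQ (hs.dvd_of_dvd_pow h))
  have hs0 : (X 0 : MvPolynomial (Fin 2) k) ^ q ≠ 0 := pow_ne_zero _ hs.ne_zero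
  obtain ⟨p, hp⟩ : (X 0 : MvPolynomial (Fin 2) k) ^ q ∣ v := by
    refine hs.pow_dvd_of_dvd_mul_right q htQ ⟨-(u * Q ^ q) - w * X 0 ^ (2 * q), ?_⟩
    linear_combination hsyz
  subst hp
  have hred : (u + p * X 1 ^ q) * Q ^ q = X 0 ^ (2 * q) * -w := by
    refine mul_left_cancel₀ hs0 ?_
    linear_combination hsyz
  obtain ⟨p₂, hp₂⟩ : (X 0 : MvPolynomial (Fin 2) k) ^ (2 * q) ∣ u + p * X 1 ^ q :=
    hs.pow_dvd_of_dvd_mul_right (2 * q) (fun h => hsQ (hs.dvd_of_dvd_pow h)) ⟨-w, hred⟩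
  refine ⟨-p, p₂, by linear_combination hp₂, by ring, ?_⟩
  refine mul_left_cancel₀ (pow_ne_zero (2 * q) hs.ne_zero) ?_
  linear_combination hred - Q ^ q * hp₂
end
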